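/- Theorem 4.1(i), second case: Suppose the symmetric, measurable, uniformly elliptic coefficients a^{ij} on ℝ^{d+1} are independent of t, i.e. a^{ij}(t,x) = a^{ij}(s,x) for all t, s, x. Let δ ∈ (0,1), let f satisfy [f]_{t,δ/2;ℝ^{d+1}_0} < ∞, and let u be a bounded classical solution of u_t − a^{ij}D_{ij}u = f in ℝ^{d+1}_0 := (−∞,0)×ℝ^d. Then there is a constant N depending only on d, q, δ, ν such that [∂_t u]_{t,δ/2;ℝ^{d+1}_0} ≤ N [f]_{t,δ/2;ℝ^{d+1}_0}. -/

import Mathlib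

open MeasureTheory Metric Set Filter

noncomputable section

/-- Spatial first-order partial derivative `D_i`. -/
def sd {d : ℕ} (i : Fin d) (v : EuclideanSpace ℝ (Fin d) → ℝ)
    (x : EuclideanSpace ℝ (Fin d)) : ℝ :=
  fderiv ℝ v x (EuclideanSpace.single i 1)

/-- Spatial second-order partial derivative `D_i D_j`. -/
def sd2 {d : ℕ} (i j : Fin d) (v : EuclideanSpace ℝ (Fin d) → ℝ)
    (x : EuclideanSpace ℝ (Fin d)) : ℝ :=
  sd i (fun y => sd j v y) x

/-- Time derivative `∂_t`. -/
def td {d : ℕ} (u : ℝ → EuclideanSpace ℝ (Fin d) → ℝ) (t : ℝ)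
    (x : EuclideanSpace ℝ (Fin d)) : ℝ :=
  deriv (fun s => u s x) t

/-- Parabolic cylinder `Q_ρ = (-ρ², 0) × B_ρ`. -/
def parQ (d : ℕ) (ρ : ℝ) : Set (ℝ × EuclideanSpace ℝ (Fin d)) :=
  Ioo (-(ρ ^ 2)) 0 ×ˢ ball (0 : EuclideanSpace ℝ (Fin d)) ρ

/-- The half space `ℝ^{d+1}_0 = (-∞, 0) × ℝ^d`. -/
def parNeg (d : ℕ) : Set (ℝ × EuclideanSpace ℝ (Fin d)) :=
  Iio (0 : ℝ) ×ˢ (univ : Set (EuclideanSpace ℝ (Fin d)))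

/-- Partial Hölder bound in the first `q` spatial coordinates `x'`. -/
def PHolderXPar (d q : ℕ) (δ : ℝ) (Q : Set (ℝ × EuclideanSpace ℝ (Fin d)))
    (g : ℝ → EuclideanSpace ℝ (Fin d) → ℝ) (K : ℝ) : Prop :=
  ∀ (t : ℝ) (x y : EuclideanSpace ℝ (Fin d)), (t, x) ∈ Q → (t, y) ∈ Q →
    (∀ i : Fin d, q ≤ (i : ℕ) → x i = y i) → |g t x - g t y| ≤ K * dist x y ^ δ

/-- Full spatial Hölder bound. -/
def HolderXPar (d : ℕ) (δ : ℝ) (Q : Set (ℝ × EuclideanSpace ℝ (Fin d)))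
    (g : ℝ → EuclideanSpace ℝ (Fin d) → ℝ) (K : ℝ) : Prop :=
  ∀ (t : ℝ) (x y : EuclideanSpace ℝ (Fin d)), (t, x) ∈ Q → (t, y) ∈ Q →
    |g t x - g t y| ≤ K * dist x y ^ δ

/-- Hölder bound in the time variable `t`, with exponent `γ`. -/
def HolderTPar (d : ℕ) (γ : ℝ) (Q : Set (ℝ × EuclideanSpace ℝ (Fin d)))
    (g : ℝ → EuclideanSpace ℝ (Fin d) → ℝ) (K : ℝ) : Prop :=
  ∀ (t s : ℝ) (x : EuclideanSpace ℝ (Fin d)), (t, x) ∈ Q → (s, x) ∈ Q →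
    |g t x - g s x| ≤ K * |t - s| ^ γ

/-- Classical regularity of parabolic solutions: `u`, `∂_t u`, `Du`, `D²u` exist and are
continuous on `Q`. -/
def ParClassical {d : ℕ} (Q : Set (ℝ × EuclideanSpace ℝ (Fin d)))
    (u : ℝ → EuclideanSpace ℝ (Fin d) → ℝ) : Prop :=
  (∀ z ∈ Q, DifferentiableAt ℝ (fun s => u s z.2) z.1) ∧
  (∀ z ∈ Q, ContDiffAt ℝ 2 (u z.1) z.2) ∧
  ContinuousOn (fun z : ℝ × EuclideanSpace ℝ (Fin d) => u z.1 z.2) Q ∧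
  ContinuousOn (fun z : ℝ × EuclideanSpace ℝ (Fin d) => td u z.1 z.2) Q ∧
  (∀ i : Fin d,
    ContinuousOn (fun z : ℝ × EuclideanSpace ℝ (Fin d) => sd i (u z.1) z.2) Q) ∧
  (∀ i j : Fin d,
    ContinuousOn (fun z : ℝ × EuclideanSpace ℝ (Fin d) => sd2 i j (u z.1) z.2) Q)

/-- Uniform ellipticity with constant `ν` (parabolic, two-sided bound). -/
def UnifEllipticP (d : ℕ) (ν : ℝ)
    (a : Fin d → Fin d → ℝ → EuclideanSpace ℝ (Fin d) → ℝ) : Prop :=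
  ∀ (t : ℝ) (x : EuclideanSpace ℝ (Fin d)) (ξ : Fin d → ℝ),
    ν * ∑ i, ξ i ^ 2 ≤ ∑ i, ∑ j, a i j t x * ξ i * ξ j ∧
      ∑ i, ∑ j, a i j t x * ξ i * ξ j ≤ ν⁻¹ * ∑ i, ξ i ^ 2


/-! ### Linear algebra -/

abbrev Eu (d : ℕ) := EuclideanSpace ℝ (Fin d)

/-- Elliptic matrices. -/
def Ell (d : ℕ) (ν : ℝ) (A : Fin d → Fin d → ℝ) : Prop :=
  (∀ i j, A i j = A j i) ∧ ∀ ξ : Fin d → ℝ,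
    ν * ∑ i, ξ i ^ 2 ≤ ∑ i, ∑ j, A i j * ξ i * ξ j ∧
      ∑ i, ∑ j, A i j * ξ i * ξ j ≤ ν⁻¹ * ∑ i, ξ i ^ 2

/-- Trace of `A * B`. -/
def trA {d : ℕ} (A : Fin d → Fin d → ℝ) (B : Eu d →L[ℝ] Eu d) : ℝ :=
  ∑ i, ∑ j, A i j * (B (EuclideanSpace.single i 1)) j

theorem trA_add {d : ℕ} (A : Fin d → Fin d → ℝ) (B C : Eu d →L[ℝ] Eu d) :
    trA A (B + C) = trA A B + trA A C := by
  simp [trA, mul_add, Finset.sum_add_distrib]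

theorem trA_smul {d : ℕ} (A : Fin d → Fin d → ℝ) (c : ℝ) (B : Eu d →L[ℝ] Eu d) :
    trA A (c • B) = c * trA A B := by
  simp only [trA, Finset.mul_sum]
  refine Finset.sum_congr rfl fun i _ => Finset.sum_congr rfl fun j _ => ?_
  simp
  ring

theorem trA_neg {d : ℕ} (A : Fin d → Fin d → ℝ) (B : Eu d →L[ℝ] Eu d) :
    trA A (-B) = - trA A B := by
  simp [trA]

theorem trA_sub {d : ℕ} (A : Fin d → Fin d → ℝ) (B C : Eu d →L[ℝ] Eu d) :
    trA A (B - C) = trA A B - trA A C := by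
  rw [sub_eq_add_neg, trA_add, trA_neg]; ring

theorem eu_sum {d : ℕ} (ξ : Eu d) : ξ = ∑ i, ξ i • (EuclideanSpace.single i (1 : ℝ) : Eu d) := by
  ext j
  simp [Finset.sum_apply, Pi.single_apply]

theorem eu_inner {d : ℕ} (x y : Eu d) : inner ℝ x y = ∑ i, x i * y i := by
  simp [PiLp.inner_apply, mul_comm]

theorem quad_expand {d : ℕ} (B : Eu d →L[ℝ] Eu d) (ξ : Eu d) :
    inner ℝ (B ξ) ξ = ∑ i, ∑ j, ξ i * ξ j * (B (EuclideanSpace.single i 1)) j := by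
  conv_lhs => rw [eu_inner]
  have : ∀ j, (B ξ) j = ∑ i, ξ i * (B (EuclideanSpace.single i 1)) j := by
    intro j
    conv_lhs => rw [eu_sum ξ]
    simp [map_sum]
  simp only [this, Finset.sum_mul]
  rw [Finset.sum_comm]
  refine Finset.sum_congr rfl fun i _ => Finset.sum_congr rfl fun j _ => by ring

open scoped MatrixOrder Matrix.Norms.L2Operator in
theorem psd_trace {d : ℕ} (A : Fin d → Fin d → ℝ) (hs : ∀ i j, A i j = A j i)
    (hA : ∀ ξ : Fin d → ℝ, 0 ≤ ∑ i, ∑ j, A i j * ξ i * ξ j)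
    (B : Eu d →L[ℝ] Eu d) (hB : ∀ ξ, 0 ≤ inner ℝ (B ξ) ξ) : 0 ≤ trA A B := by
  have hp : (Matrix.of A).PosSemidef := by
    refine Matrix.PosSemidef.of_dotProduct_mulVec_nonneg ?_ ?_
    · ext i j; simp [Matrix.conjTranspose_apply, hs i j]
    · intro x
      have := hA x
      simp only [dotProduct, Matrix.mulVec, Finset.mul_sum]
      refine this.trans_eq ?_
      refine Finset.sum_congr rfl fun i _ => Finset.sum_congr rfl fun j _ => by simp; ring
  obtain ⟨C, hC⟩ := CStarAlgebra.nonneg_iff_eq_star_mul_self.mp hp.nonneg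
  have hAC : ∀ i j, A i j = ∑ k, C k i * C k j := by
    intro i j
    have := congrFun (congrFun hC i) j
    simpa [Matrix.mul_apply] using this
  have : trA A B = ∑ k, inner ℝ (B (WithLp.toLp 2 (C k))) (WithLp.toLp 2 (C k)) := by
    simp only [quad_expand, trA, hAC, Finset.sum_mul]
    symm
    rw [Finset.sum_comm]
    refine Finset.sum_congr rfl fun i _ => ?_
    rw [Finset.sum_comm]
  rw [this]
  exact Finset.sum_nonneg fun k _ => hB _

theorem Ell.diag_le {d : ℕ} {ν : ℝ} {A : Fin d → Fin d → ℝ} (hA : Ell d ν A) (i : Fin d) :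
    ν ≤ A i i ∧ A i i ≤ ν⁻¹ := by
  have := hA.2 (Pi.single i 1)
  simpa [Pi.single_apply, Finset.sum_ite_eq] using this

theorem Ell.diag_sum {d : ℕ} {ν : ℝ} {A : Fin d → Fin d → ℝ} (hA : Ell d ν A) :
    ∑ i, A i i ≤ d * ν⁻¹ := by
  calc ∑ i, A i i ≤ ∑ i : Fin d, ν⁻¹ := Finset.sum_le_sum fun i _ => (hA.diag_le i).2
    _ = _ := by simp

theorem trA_id {d : ℕ} (A : Fin d → Fin d → ℝ) :
    trA A (ContinuousLinearMap.id ℝ (Eu d)) = ∑ i, A i i := by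
  simp [trA, Pi.single_apply]

theorem trA_rank1 {d : ℕ} (A : Fin d → Fin d → ℝ) (y : Eu d) :
    trA A ((innerSL ℝ y).smulRight y) = ∑ i, ∑ j, A i j * y i * y j := by
  simp only [trA]
  refine Finset.sum_congr rfl fun i _ => Finset.sum_congr rfl fun j _ => ?_
  simp [EuclideanSpace.inner_single_right]
  ring

theorem tr_lower {d : ℕ} {ν : ℝ} (hν : 0 < ν) {A : Fin d → Fin d → ℝ} (hA : Ell d ν A)
    (H : Eu d →L[ℝ] Eu d) (y : Eu d) (α β : ℝ) (hα : 0 ≤ α)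
    (h : ∀ ξ, α * inner ℝ y ξ ^ 2 + β * ‖ξ‖ ^ 2 ≤ inner ℝ (H ξ) ξ) :
    α * ν * ‖y‖ ^ 2 + β * ∑ i, A i i ≤ trA A H := by
  have h0 : 0 ≤ trA A (H - α • ((innerSL ℝ y).smulRight y) - β • ContinuousLinearMap.id ℝ (Eu d)) := by
    refine psd_trace A hA.1 (fun ξ => le_trans ?_ (hA.2 ξ).1) _ ?_
    · have : 0 ≤ ∑ i, ξ i ^ 2 := Finset.sum_nonneg fun i _ => sq_nonneg _
      positivity
    · intro ξ
      have := h ξ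
      simp only [_root_.sub_apply, _root_.smul_apply,
        ContinuousLinearMap.smulRight_apply, innerSL_apply_apply, ContinuousLinearMap.id_apply,
        inner_sub_left, inner_smul_left, real_inner_self_eq_norm_sq]
      simp only [conj_trivial]
      nlinarith
  rw [trA_sub, trA_sub, trA_smul, trA_smul, trA_id, trA_rank1] at h0
  have h1 := (hA.2 y).1
  have h2 : ‖y‖ ^ 2 = ∑ i, y i ^ 2 := by simp [EuclideanSpace.norm_sq_eq]
  rw [h2]
  nlinarith [mul_le_mul_of_nonneg_left h1 hα]

theorem hess_upper {d : ℕ} {ν : ℝ} (hν : 0 < ν) {A : Fin d → Fin d → ℝ} (hA : Ell d ν A)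
    (H : Eu d →L[ℝ] Eu d) (k F : ℝ) (hk : 0 ≤ k)
    (h : ∀ ξ, -k * ‖ξ‖ ^ 2 ≤ inner ℝ (H ξ) ξ) (hF : trA A H ≤ F) (ξ : Eu d) :
    inner ℝ (H ξ) ξ ≤ ((F + k * (d * ν⁻¹)) / ν) * ‖ξ‖ ^ 2 := by
  set B := H + k • ContinuousLinearMap.id ℝ (Eu d) with hBdef
  have hB : ∀ ξ, 0 ≤ inner ℝ (B ξ) ξ := by
    intro ξ
    have := h ξ
    simp only [hBdef, _root_.add_apply, _root_.smul_apply,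
      ContinuousLinearMap.id_apply, inner_add_left, inner_smul_left, real_inner_self_eq_norm_sq,
      conj_trivial]
    linarith
  -- identity matrix
  set I : Fin d → Fin d → ℝ := fun i j => if i = j then 1 else 0 with hI
  have hIq : ∀ ξ : Fin d → ℝ, ∑ i, ∑ j, I i j * ξ i * ξ j = ∑ i, ξ i ^ 2 := by
    intro ξ
    refine Finset.sum_congr rfl fun i _ => ?_
    simp [hI, sq]
  have h1 : 0 ≤ trA (fun i j => A i j - ν * I i j) B := by
    refine psd_trace _ (fun i j => ?_) (fun ξ => ?_) B hB
    · rw [hA.1 i j]; simp [hI, eq_comm]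
    · have := (hA.2 ξ).1
      rw [← hIq] at this
      simp only [sub_mul, Finset.sum_sub_distrib, Finset.mul_sum, mul_assoc] at this ⊢
      linarith
  have h1' : trA (fun i j => A i j - ν * I i j) B = trA A B - ν * trA I B := by
    simp only [trA, sub_mul, Finset.sum_sub_distrib, Finset.mul_sum, mul_assoc]
  have h2 : 0 ≤ trA (fun i j => ‖ξ‖ ^ 2 * I i j - ξ i * ξ j) B := by
    refine psd_trace _ (fun i j => ?_) (fun η => ?_) B hB
    · simp only [hI, eq_comm]; ring
    · have e1 : ∑ i, ∑ j, (‖ξ‖ ^ 2 * I i j - ξ i * ξ j) * η i * η j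
          = ‖ξ‖ ^ 2 * ∑ i, η i ^ 2 - (∑ i, ξ i * η i) ^ 2 := by
        rw [← hIq, sq (∑ i, ξ i * η i), Finset.sum_mul_sum]
        simp only [sub_mul, Finset.sum_sub_distrib, Finset.mul_sum, mul_assoc]
        congr 1
        refine Finset.sum_congr rfl fun i _ => Finset.sum_congr rfl fun j _ => by ring
      rw [e1]
      have h2 : ‖ξ‖ ^ 2 = ∑ i, ξ i ^ 2 := by simp [EuclideanSpace.norm_sq_eq]
      rw [h2]
      have := Finset.sum_mul_sq_le_sq_mul_sq Finset.univ (fun i => ξ i) η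
      linarith
  have h2' : trA (fun i j => ‖ξ‖ ^ 2 * I i j - ξ i * ξ j) B = ‖ξ‖ ^ 2 * trA I B - inner ℝ (B ξ) ξ := by
    rw [quad_expand]
    simp only [trA, sub_mul, Finset.sum_sub_distrib, Finset.mul_sum, mul_assoc]
  have h3 : inner ℝ (H ξ) ξ ≤ inner ℝ (B ξ) ξ := by
    simp only [hBdef, _root_.add_apply, _root_.smul_apply,
      ContinuousLinearMap.id_apply, inner_add_left, inner_smul_left, real_inner_self_eq_norm_sq,
      conj_trivial]
    nlinarith [sq_nonneg ‖ξ‖]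
  have h4 : trA A B ≤ F + k * (d * ν⁻¹) := by
    rw [hBdef, trA_add, trA_smul, trA_id]
    have := mul_le_mul_of_nonneg_left hA.diag_sum hk
    linarith
  have h5 : trA I B ≤ (F + k * (d * ν⁻¹)) / ν := by
    rw [le_div_iff₀ hν]; linarith
  nlinarith [mul_le_mul_of_nonneg_right h5 (sq_nonneg ‖ξ‖)]

theorem opnorm_of_quad {d : ℕ} (H : Eu d →L[ℝ] Eu d)
    (hs : ∀ x y, inner ℝ (H x) y = inner ℝ (H y) x) (C : ℝ) (hC : 0 < C)
    (h : ∀ ξ, |inner ℝ (H ξ) ξ| ≤ C * ‖ξ‖ ^ 2) : ‖H‖ ≤ C := by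
  refine ContinuousLinearMap.opNorm_le_bound _ hC.le fun ξ => ?_
  set η := C⁻¹ • H ξ with hη
  have e : inner ℝ (H (ξ + η)) (ξ + η) - inner ℝ (H (ξ - η)) (ξ - η) = 4 * inner ℝ (H ξ) η := by
    simp only [map_add, map_sub, inner_add_left, inner_add_right, inner_sub_left, inner_sub_right]
    rw [hs η ξ]; ring
  have h1 := (abs_le.1 (h (ξ + η))).2
  have h2 := (abs_le.1 (h (ξ - η))).1
  have h3 : ‖ξ + η‖ ^ 2 + ‖ξ - η‖ ^ 2 = 2 * (‖ξ‖ ^ 2 + ‖η‖ ^ 2) := by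
    have := parallelogram_law_with_norm ℝ ξ η
    nlinarith
  have h4 : inner ℝ (H ξ) η = C⁻¹ * ‖H ξ‖ ^ 2 := by
    rw [hη, inner_smul_right, real_inner_self_eq_norm_sq]
  have h5 : ‖η‖ = C⁻¹ * ‖H ξ‖ := by
    rw [hη, norm_smul, Real.norm_of_nonneg (by positivity)]
  rw [h5] at h3
  rw [h4] at e
  have h6 : 4 * (C⁻¹ * ‖H ξ‖ ^ 2) ≤ C * (2 * (‖ξ‖ ^ 2 + (C⁻¹ * ‖H ξ‖) ^ 2)) := by
    rw [← h3, ← e]; linarith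
  have h7 : ‖H ξ‖ ^ 2 ≤ (C * ‖ξ‖) ^ 2 := by
    field_simp at h6
    nlinarith
  exact (abs_le_of_sq_le_sq' h7 (by positivity)).2

theorem abs_det_le {d : ℕ} (T : Eu d →L[ℝ] Eu d) : |T.det| ≤ ‖T‖ ^ d := by
  have h1 := MeasureTheory.Measure.addHaar_image_continuousLinearMap (volume : Measure (Eu d)) T (ball 0 1)
  have h2 : T '' ball 0 1 ⊆ closedBall 0 ‖T‖ := by
    rintro _ ⟨x, hx, rfl⟩
    rw [mem_closedBall_zero_iff]
    rw [mem_ball_zero_iff] at hx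
    calc ‖T x‖ ≤ ‖T‖ * ‖x‖ := T.le_opNorm x
      _ ≤ ‖T‖ * 1 := by gcongr
      _ = ‖T‖ := mul_one _
  have h3 := measure_mono (μ := (volume : Measure (Eu d))) h2
  rw [h1, Measure.addHaar_closedBall _ _ (norm_nonneg _)] at h3
  have hpos : (volume (ball (0 : Eu d) 1)) ≠ 0 := (measure_ball_pos _ _ one_pos).ne'
  have hfin : (volume (ball (0 : Eu d) 1)) ≠ ⊤ := measure_ball_lt_top.ne
  rw [ENNReal.mul_le_mul_iff_left hpos hfin] at h3
  have := (ENNReal.ofReal_le_ofReal_iff (by positivity)).1 h3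
  simpa using this

/-! ### Touching -/

structure C2 {d : ℕ} (w : Eu d → ℝ) (g : Eu d → Eu d) (H : Eu d → Eu d →L[ℝ] Eu d) : Prop where
  d1 : ∀ x, HasFDerivAt w (innerSL ℝ (g x)) x
  d2 : ∀ x, HasFDerivAt g (H x) x

theorem C2.symm {d : ℕ} {w : Eu d → ℝ} {g : Eu d → Eu d} {H : Eu d → Eu d →L[ℝ] Eu d}
    (hw : C2 w g H) (x ξ η : Eu d) : inner ℝ (H x ξ) η = inner ℝ (H x η) ξ := by
  have h2 : HasFDerivAt (fun y => innerSL ℝ (g y)) ((innerSL ℝ).toContinuousLinearMap ∘L (H x)) x :=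
    ((innerSL ℝ : Eu d →L⋆[ℝ] _).toContinuousLinearMap.hasFDerivAt).comp x (hw.d2 x)
  have := second_derivative_symmetric (f := w) (fun y => hw.d1 y) h2 ξ η
  simpa using this

theorem second_nonneg (ψ ψ1 : ℝ → ℝ) (c : ℝ) (h1 : ∀ s, HasDerivAt ψ (ψ1 s) s)
    (h2 : HasDerivAt ψ1 c 0) (hmin : IsLocalMin ψ 0) : 0 ≤ c := by
  by_contra hc
  push Not at hc
  have e1 : deriv ψ = ψ1 := funext fun s => (h1 s).deriv
  have hz : ψ1 0 = 0 := hmin.hasDerivAt_eq_zero (h1 0)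
  have hmax : IsLocalMax ψ 0 := by
    apply isLocalMax_of_deriv_deriv_neg
    · rw [e1, h2.deriv]; exact hc
    · rw [e1, hz]
    · exact (h1 0).continuousAt
  have hconst : ∀ᶠ s in nhds 0, ψ s = ψ 0 := by
    filter_upwards [hmin, hmax] with s a b using le_antisymm b a
  have hd : ∀ᶠ s in nhds (0 : ℝ), ψ1 s = 0 := by
    filter_upwards [hconst.eventually_nhds] with s hs
    have : HasDerivAt ψ 0 s := (hasDerivAt_const s (ψ 0)).congr_of_eventuallyEq hs
    exact (h1 s).unique this
  have : HasDerivAt ψ1 0 0 := (hasDerivAt_const (0 : ℝ) (0 : ℝ)).congr_of_eventuallyEq hd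
  have := h2.unique this
  linarith

theorem C2.line1 {d : ℕ} {w : Eu d → ℝ} {g : Eu d → Eu d} {H : Eu d → Eu d →L[ℝ] Eu d}
    (hw : C2 w g H) (z ξ : Eu d) (s : ℝ) :
    HasDerivAt (fun s : ℝ => w (z + s • ξ)) (inner ℝ (g (z + s • ξ)) ξ) s := by
  have hl : HasDerivAt (fun s : ℝ => z + s • ξ) ξ s := by
    simpa using ((hasDerivAt_id s).smul_const ξ).const_add z
  exact ((hw.d1 (z + s • ξ)).comp_hasDerivAt s hl).congr_deriv (by simp)

theorem C2.touch {d : ℕ} {w : Eu d → ℝ} {g : Eu d → Eu d} {H : Eu d → Eu d →L[ℝ] Eu d}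
    (hw : C2 w g H) (z ξ : Eu d) (b b1 : ℝ → ℝ) (c : ℝ) (hb : ∀ s, HasDerivAt b (b1 s) s)
    (hb1 : HasDerivAt b1 c 0) (hmin : IsLocalMin (fun s : ℝ => w (z + s • ξ) - b s) 0) :
    c ≤ inner ℝ (H z ξ) ξ := by
  have hl : HasDerivAt (fun s : ℝ => z + s • ξ) ξ 0 := by
    simpa using ((hasDerivAt_id (0 : ℝ)).smul_const ξ).const_add z
  have h2 : HasDerivAt (fun s : ℝ => inner ℝ (g (z + s • ξ)) ξ) (inner ℝ (H z ξ) ξ) 0 := by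
    have h0 : HasFDerivAt g (H z) (z + (0 : ℝ) • ξ) := by simpa using hw.d2 z
    have h3 : HasDerivAt (fun s : ℝ => g (z + s • ξ)) (H z ξ) 0 := h0.comp_hasDerivAt 0 hl
    have := h3.inner ℝ (hasDerivAt_const (0 : ℝ) ξ)
    simpa using this
  have := second_nonneg _ _ _ (fun s => (hw.line1 z ξ s).sub (hb s)) (h2.sub hb1) hmin
  linarith

theorem expo_d1 (k0 k1 k2 k3 p0 p1 p2 s : ℝ) :
    HasDerivAt (fun s : ℝ => k0 + k1 * s + k2 * s ^ 2 + k3 * Real.exp (p0 + p1 * s + p2 * s ^ 2))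
      (k1 + 2 * k2 * s + k3 * Real.exp (p0 + p1 * s + p2 * s ^ 2) * (p1 + 2 * p2 * s)) s := by
  have hq : ∀ a b c : ℝ, HasDerivAt (fun s : ℝ => a + b * s + c * s ^ 2) (b + 2 * c * s) s := by
    intro a b c
    have := (((hasDerivAt_id s).const_mul b).const_add a).add (((hasDerivAt_id s).pow 2).const_mul c)
    refine this.congr_deriv ?_
    simp; ring
  have := (hq k0 k1 k2).add ((hq p0 p1 p2).exp.const_mul k3)
  refine this.congr_deriv ?_
  ring

theorem expo_d2 (k1 k2 k3 p0 p1 p2 : ℝ) :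
    HasDerivAt (fun s : ℝ =>
      k1 + 2 * k2 * s + k3 * Real.exp (p0 + p1 * s + p2 * s ^ 2) * (p1 + 2 * p2 * s))
      (2 * k2 + k3 * Real.exp p0 * (p1 ^ 2 + 2 * p2)) 0 := by
  have h1 := expo_d1 0 0 0 k3 p0 p1 p2 0
  have h1' : HasDerivAt (fun s : ℝ => k3 * Real.exp (p0 + p1 * s + p2 * s ^ 2))
      (k3 * Real.exp p0 * p1) 0 := by
    simpa using h1
  have h2 : HasDerivAt (fun s : ℝ => p1 + 2 * p2 * s) (2 * p2) 0 := by
    simpa using ((hasDerivAt_id (0 : ℝ)).const_mul (2 * p2)).const_add p1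
  have h3 : HasDerivAt (fun s : ℝ => k1 + 2 * k2 * s) (2 * k2) 0 := by
    simpa using ((hasDerivAt_id (0 : ℝ)).const_mul (2 * k2)).const_add k1
  refine (h3.add (h1'.mul h2)).congr_deriv ?_
  simp; ring

theorem norm_line_sq {d : ℕ} (y ξ : Eu d) (s : ℝ) :
    ‖y + s • ξ‖ ^ 2 = ‖y‖ ^ 2 + 2 * inner ℝ y ξ * s + ‖ξ‖ ^ 2 * s ^ 2 := by
  rw [norm_add_sq_real, inner_smul_right, norm_smul, mul_pow, Real.norm_eq_abs, sq_abs]; ring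

theorem localMin_line {d : ℕ} {Φ : Eu d → ℝ} {z : Eu d} (h : IsLocalMin Φ z) (ξ : Eu d) :
    IsLocalMin (fun s : ℝ => Φ (z + s • ξ)) 0 := by
  have hc : ContinuousAt (fun s : ℝ => z + s • ξ) 0 := by fun_prop
  have h0 : z + (0 : ℝ) • ξ = z := by simp
  have : IsLocalMin Φ (z + (0 : ℝ) • ξ) := by rw [h0]; exact h
  exact IsMinFilter.comp_tendsto this hc

/-- Contact set with opening `a`. -/
def Ct {d : ℕ} (w : Eu d → ℝ) (g : Eu d → Eu d) (a : ℝ) : Set (Eu d) :=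
  {x | ‖g x‖ ≤ a ∧ w x ≤ a ∧ ∀ z ∈ closedBall (0 : Eu d) 10,
    w x + inner ℝ (g x) (z - x) - a / 2 * ‖z - x‖ ^ 2 ≤ w z}

set_option maxHeartbeats 1000000 in
theorem step1 (d : ℕ) (ν : ℝ) (hν : 0 < ν) : ∃ C1 : ℝ, 0 < C1 ∧
    ∀ (w : Eu d → ℝ) (g : Eu d → Eu d) (H : Eu d → Eu d →L[ℝ] Eu d), C2 w g H →
    (∀ x, ∃ A, Ell d ν A ∧ trA A (H x) ≤ 1) →
    ∀ (a r : ℝ) (x0 x1 : Eu d), 1 ≤ a → 0 < r → closedBall x0 (2 * r) ⊆ closedBall 0 10 →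
    dist x1 x0 ≤ r → x1 ∈ Ct w g a →
    ∃ z1 ∈ closedBall x0 (r / 16),
      w z1 - (w x1 + inner ℝ (g x1) (z1 - x1) - a / 2 * ‖z1 - x1‖ ^ 2) ≤ C1 * a * r ^ 2 := by
  set D : ℝ := d * ν⁻¹ with hD
  have hD0 : 0 ≤ D := by positivity
  set β : ℝ := 64 * (2 * D + 1) / ν + 1 with hβ
  have hβ1 : 1 ≤ β := by
    have : 0 ≤ 64 * (2 * D + 1) / ν := by positivity
    linarith
  have hββ : 1 ≤ β ^ 2 * ν / 64 - 2 * β * D := by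
    have h1 : β * ν = 64 * (2 * D + 1) + ν := by
      rw [hβ]; field_simp
    have h3 : 1 + 2 * D ≤ β * ν / 64 := by
      rw [h1]; linarith
    nlinarith
  set κ : ℝ := Real.exp (4 * β) * (2 + D) with hκ
  have hκ0 : 0 < κ := by positivity
  refine ⟨κ, hκ0, ?_⟩
  intro w g H hw hEq a r x0 x1 ha hr hsub hx1 hct
  by_contra hcon
  push Not at hcon
  set b : Eu d → ℝ := fun z => a * r ^ 2 * κ * (Real.exp (-β / r ^ 2 * ‖z - x0‖ ^ 2) - Real.exp (-4 * β)) with hb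
  set Φ : Eu d → ℝ := fun z =>
    w z - (w x1 + inner ℝ (g x1) (z - x1) - a / 2 * ‖z - x1‖ ^ 2) - b z with hΦ
  have hwc : Continuous w := continuous_iff_continuousAt.2 fun x => (hw.d1 x).continuousAt
  have hΦc : Continuous Φ := by
    rw [hΦ, hb]; fun_prop
  have ha0 : 0 < a := by linarith
  have hx1mem : x1 ∈ closedBall x0 (2 * r) := by
    rw [mem_closedBall]; linarith
  obtain ⟨z, hzmem, hzmin⟩ := (isCompact_closedBall x0 (2 * r)).exists_isMinOn ⟨x1, hx1mem⟩ hΦc.continuousOn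
  have hΦx1 : Φ x1 < 0 := by
    have : 0 < b x1 := by
      have h1 : -4 * β < -β / r ^ 2 * ‖x1 - x0‖ ^ 2 := by
        rw [dist_eq_norm] at hx1
        have h2 : ‖x1 - x0‖ ^ 2 / r ^ 2 ≤ 1 := by
          rw [div_le_one (by positivity)]
          exact pow_le_pow_left₀ (norm_nonneg _) hx1 2
        have h3 : -β / r ^ 2 * ‖x1 - x0‖ ^ 2 = -β * (‖x1 - x0‖ ^ 2 / r ^ 2) := by ring
        rw [h3]; nlinarith
      have := Real.exp_lt_exp.2 h1
      have h4 : 0 < Real.exp (-β / r ^ 2 * ‖x1 - x0‖ ^ 2) - Real.exp (-4 * β) := by linarith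
      simp only [hb]; positivity
    simp only [hΦ]; simp; linarith
  have hz0 : Φ z < 0 := lt_of_le_of_lt (hzmin hx1mem) hΦx1
  -- not in inner ball
  have hin : r / 16 < ‖z - x0‖ := by
    by_contra hle
    push Not at hle
    have h1 := hcon z (by rw [mem_closedBall, dist_eq_norm]; exact hle)
    have h2 : b z ≤ κ * a * r ^ 2 := by
      have : Real.exp (-β / r ^ 2 * ‖z - x0‖ ^ 2) ≤ 1 := by
        rw [Real.exp_le_one_iff]
        have : 0 ≤ β / r ^ 2 * ‖z - x0‖ ^ 2 := by positivity
        have e : -β / r ^ 2 * ‖z - x0‖ ^ 2 = -(β / r ^ 2 * ‖z - x0‖ ^ 2) := by ring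
        linarith
      have h3 := Real.exp_pos (-4 * β)
      have h4 : Real.exp (-β / r ^ 2 * ‖z - x0‖ ^ 2) - Real.exp (-4 * β) ≤ 1 := by linarith
      simp only [hb]
      calc _ ≤ a * r ^ 2 * κ * 1 := by gcongr
        _ = _ := by ring
    simp only [hΦ] at hz0; linarith
  have hout : ‖z - x0‖ < 2 * r := by
    rw [mem_closedBall, dist_eq_norm] at hzmem
    refine lt_of_le_of_ne hzmem fun heq => ?_
    have h1 : b z = 0 := by
      have : -β / r ^ 2 * (2 * r) ^ 2 = -4 * β := by field_simp; ring
      simp only [hb, heq, this]; simp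
    have h2 := hct.2.2 z (hsub (by rw [mem_closedBall, dist_eq_norm]; exact hzmem))
    simp only [hΦ, h1] at hz0; linarith
  have hloc : IsLocalMin Φ z := by
    refine hzmin.isLocalMin ?_
    refine closedBall_mem_nhds_of_mem ?_
    rw [mem_ball, dist_eq_norm]; exact hout
  obtain ⟨A, hA, hA1⟩ := hEq z
  set y := z - x0 with hy
  set e0 := Real.exp (-β / r ^ 2 * ‖y‖ ^ 2) with he0
  have he0p : 0 < e0 := Real.exp_pos _
  have hquad : ∀ ξ, (a * κ * e0 * 4 * β ^ 2 / r ^ 2) * inner ℝ y ξ ^ 2 + (-a - 2 * β * a * κ * e0) * ‖ξ‖ ^ 2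
      ≤ inner ℝ (H z ξ) ξ := by
    intro ξ
    have hm := localMin_line hloc ξ
    set k0 := w x1 + inner ℝ (g x1) (z - x1) - a / 2 * ‖z - x1‖ ^ 2 - a * r ^ 2 * κ * Real.exp (-4 * β)
    set k1 := inner ℝ (g x1) ξ - a * inner ℝ (z - x1) ξ
    have hm' : IsLocalMin (fun s : ℝ => w (z + s • ξ) - (k0 + k1 * s + (- a / 2 * ‖ξ‖ ^ 2) * s ^ 2 +
        (a * r ^ 2 * κ) * Real.exp ((-β / r ^ 2 * ‖y‖ ^ 2) + (-β / r ^ 2 * (2 * inner ℝ y ξ)) * s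
          + (-β / r ^ 2 * ‖ξ‖ ^ 2) * s ^ 2))) 0 := by
      convert hm using 2 with s
      simp only [hΦ, hb]
      have e1 : z + s • ξ - x0 = y + s • ξ := by rw [hy]; abel
      have e2 : z + s • ξ - x1 = (z - x1) + s • ξ := by abel
      rw [e1, e2, norm_line_sq, norm_line_sq, inner_add_right, inner_smul_right]
      have e3 : -β / r ^ 2 * (‖y‖ ^ 2 + 2 * inner ℝ y ξ * s + ‖ξ‖ ^ 2 * s ^ 2) =
        (-β / r ^ 2 * ‖y‖ ^ 2) + (-β / r ^ 2 * (2 * inner ℝ y ξ)) * s + (-β / r ^ 2 * ‖ξ‖ ^ 2) * s ^ 2 := by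
        ring
      rw [e3]
      simp only [k0, k1]
      ring
    have := hw.touch z ξ _ _ _ (expo_d1 _ _ _ _ _ _ _) (expo_d2 _ _ _ _ _ _) hm'
    refine le_trans (le_of_eq ?_) this
    rw [← he0]
    field_simp
    ring
  have htr := tr_lower hν hA (H z) y _ _ (by positivity) hquad
  have hS0 : ∑ i, A i i ≤ D := hA.diag_sum
  have hyn : r ^ 2 / 256 ≤ ‖y‖ ^ 2 := by nlinarith
  have h1 : a * κ * e0 * (β ^ 2 * ν / 64) ≤ a * κ * e0 * 4 * β ^ 2 / r ^ 2 * ν * ‖y‖ ^ 2 := by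
    have : a * κ * e0 * (β ^ 2 * ν / 64) = a * κ * e0 * 4 * β ^ 2 / r ^ 2 * ν * (r ^ 2 / 256) := by
      field_simp; ring
    rw [this]; gcongr
  have h2 : (a + 2 * β * a * κ * e0) * ∑ i, A i i ≤ (a + 2 * β * a * κ * e0) * D := by gcongr
  have h3 : 2 + D ≤ κ * e0 := by
    have h4 : Real.exp (-(4 * β)) ≤ e0 := by
      rw [he0]; apply Real.exp_le_exp.2
      have h5 : ‖y‖ ^ 2 ≤ (2 * r) ^ 2 := pow_le_pow_left₀ (norm_nonneg _) hout.le 2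
      have h6 : ‖y‖ ^ 2 / r ^ 2 ≤ 4 := by
        rw [div_le_iff₀ (by positivity)]; linarith
      have h7 : -β / r ^ 2 * ‖y‖ ^ 2 = -β * (‖y‖ ^ 2 / r ^ 2) := by ring
      rw [h7]; nlinarith
    have h5 : Real.exp (4 * β) * Real.exp (-(4 * β)) = 1 := by
      rw [← Real.exp_add]; simp
    calc 2 + D = (Real.exp (4 * β) * Real.exp (-(4 * β))) * (2 + D) := by rw [h5, one_mul]
      _ = κ * Real.exp (-(4 * β)) := by rw [hκ]; ring
      _ ≤ κ * e0 := by gcongr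
  have h4 : a * (κ * e0) * 1 ≤ a * (κ * e0) * (β ^ 2 * ν / 64 - 2 * β * D) := by
    gcongr
  have h5 : a * (2 + D) ≤ a * (κ * e0) := by gcongr
  nlinarith

/-! ### The measure lemma -/

theorem C2.cw {d : ℕ} {w : Eu d → ℝ} {g : Eu d → Eu d} {H : Eu d → Eu d →L[ℝ] Eu d}
    (hw : C2 w g H) : Continuous w :=
  continuous_iff_continuousAt.2 fun x => (hw.d1 x).continuousAt

theorem C2.cg {d : ℕ} {w : Eu d → ℝ} {g : Eu d → Eu d} {H : Eu d → Eu d →L[ℝ] Eu d}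
    (hw : C2 w g H) : Continuous g :=
  continuous_iff_continuousAt.2 fun x => (hw.d2 x).continuousAt

theorem min_grad {d : ℕ} {w : Eu d → ℝ} {g : Eu d → Eu d} {H : Eu d → Eu d →L[ℝ] Eu d}
    (hw : C2 w g H) (z x1 y q : Eu d) (a1 a2 : ℝ)
    (hmin : IsLocalMin (fun z' => w z' + a1 * ‖z' - x1‖ ^ 2 + a2 * ‖z' - y‖ ^ 2
      - inner ℝ q (z' - x1)) z) :
    g z = q - (2 * a1) • (z - x1) - (2 * a2) • (z - y) := by
  have key : ∀ ξ, inner ℝ (g z - (q - (2 * a1) • (z - x1) - (2 * a2) • (z - y))) ξ = 0 := by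
    intro ξ
    have hm := localMin_line hmin ξ
    set k1 := inner ℝ q ξ - 2 * a1 * inner ℝ (z - x1) ξ - 2 * a2 * inner ℝ (z - y) ξ with hk1
    set k0 := inner ℝ q (z - x1) - a1 * ‖z - x1‖ ^ 2 - a2 * ‖z - y‖ ^ 2
    have hm' : IsLocalMin (fun s : ℝ => w (z + s • ξ) - (k0 + k1 * s + (- a1 * ‖ξ‖ ^ 2 - a2 * ‖ξ‖ ^ 2) * s ^ 2 +
        0 * Real.exp (0 + 0 * s + 0 * s ^ 2))) 0 := by
      convert hm using 2 with s
      have e1 : z + s • ξ - y = (z - y) + s • ξ := by abel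
      have e2 : z + s • ξ - x1 = (z - x1) + s • ξ := by abel
      rw [e1, e2, norm_line_sq, norm_line_sq, inner_add_right, inner_smul_right]
      simp only [k0, k1]
      ring
    have h1 := (hw.line1 z ξ 0).sub (expo_d1 k0 k1 (- a1 * ‖ξ‖ ^ 2 - a2 * ‖ξ‖ ^ 2) 0 0 0 0 0)
    have h2 := hm'.hasDerivAt_eq_zero h1
    simp only [inner_sub_left, inner_smul_left, conj_trivial]
    simp at h2
    rw [hk1] at h2
    simp only [inner_sub_left] at h2
    linarith
  exact sub_eq_zero.1 (inner_self_eq_zero.1 (key _))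

theorem Ct_hess {d : ℕ} {w : Eu d → ℝ} {g : Eu d → Eu d} {H : Eu d → Eu d →L[ℝ] Eu d}
    (hw : C2 w g H) (b : ℝ) (x : Eu d) (hx : x ∈ Ct w g b) (hx' : x ∈ ball (0 : Eu d) 10) (ξ : Eu d) :
    -b * ‖ξ‖ ^ 2 ≤ inner ℝ (H x ξ) ξ := by
  have hloc : IsLocalMin (fun z => w z - (w x + inner ℝ (g x) (z - x) - b / 2 * ‖z - x‖ ^ 2)) x := by
    filter_upwards [isOpen_ball.mem_nhds hx'] with z hz
    have := hx.2.2 z (ball_subset_closedBall hz)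
    simp; linarith
  have hm := localMin_line hloc ξ
  have hm' : IsLocalMin (fun s : ℝ => w (x + s • ξ) - (w x + (inner ℝ (g x) ξ) * s + (- b / 2 * ‖ξ‖ ^ 2) * s ^ 2 +
        0 * Real.exp (0 + 0 * s + 0 * s ^ 2))) 0 := by
    convert hm using 2 with s
    have e2 : x + s • ξ - x = s • ξ := by abel
    rw [e2, inner_smul_right, norm_smul, mul_pow, Real.norm_eq_abs, sq_abs]
    ring
  have := hw.touch x ξ _ _ _ (expo_d1 _ _ _ _ _ _ _) (expo_d2 _ _ _ _ _ _) hm'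
  linarith

theorem Ct_closed {d : ℕ} {w : Eu d → ℝ} {g : Eu d → Eu d} {H : Eu d → Eu d →L[ℝ] Eu d}
    (hw : C2 w g H) (b : ℝ) : IsClosed (Ct w g b) := by
  have h1 := hw.cw
  have h2 := hw.cg
  have : Ct w g b = {x | ‖g x‖ ≤ b} ∩ ({x | w x ≤ b} ∩ ⋂ z ∈ closedBall (0 : Eu d) 10,
    {x | w x + inner ℝ (g x) (z - x) - b / 2 * ‖z - x‖ ^ 2 ≤ w z}) := by
    ext x; simp [Ct]
  rw [this]
  refine (isClosed_le (by fun_prop) (by fun_prop)).inter ((isClosed_le (by fun_prop) (by fun_prop)).inter ?_)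
  exact isClosed_biInter fun z _ => isClosed_le (by fun_prop) (by fun_prop)

theorem Ct_mono {d : ℕ} (w : Eu d → ℝ) (g : Eu d → Eu d) {a b : ℝ} (h : a ≤ b) :
    Ct w g a ⊆ Ct w g b := by
  rintro x ⟨h1, h2, h3⟩
  refine ⟨h1.trans h, h2.trans h, fun z hz => le_trans ?_ (h3 z hz)⟩
  have : a / 2 * ‖z - x‖ ^ 2 ≤ b / 2 * ‖z - x‖ ^ 2 := by gcongr
  linarith

set_option maxHeartbeats 2000000 in
theorem mainlem (d : ℕ) (ν : ℝ) (hν : 0 < ν) : ∃ C c : ℝ, 1 ≤ C ∧ 0 < c ∧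
    ∀ (w : Eu d → ℝ) (g : Eu d → Eu d) (H : Eu d → Eu d →L[ℝ] Eu d), C2 w g H →
    (∀ x, ∃ A, Ell d ν A ∧ trA A (H x) ≤ 1) →
    ∀ (a r : ℝ) (x0 x1 : Eu d), 1 ≤ a → 0 < r → r ≤ 4 → closedBall x0 (2 * r) ⊆ closedBall 0 10 →
    dist x1 x0 ≤ r → x1 ∈ Ct w g a →
    ENNReal.ofReal c * volume (closedBall x0 (r / 8)) ≤ volume (Ct w g (C * a) ∩ ball x0 (r / 8)) := by
  obtain ⟨C1, hC1, hstep⟩ := step1 d ν hν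
  set D : ℝ := d * ν⁻¹ with hD
  have hD0 : 0 ≤ D := by positivity
  set m : ℝ := 400 * C1 with hm
  have hm0 : 0 < m := by positivity
  set C : ℝ := 1 + 8 + 4 * m + 16 * (C1 + m) with hC
  have hC0 : 1 ≤ C := by rw [hC]; nlinarith
  set C4 : ℝ := C + (1 + C * D) / ν with hC4
  have hC40 : 0 < C4 := by positivity
  set C3 : ℝ := 1 + (C4 + 1) / m with hC3
  have hC30 : 0 < C3 := by positivity
  refine ⟨C, 1 / (8 ^ d * C3 ^ d), hC0, by positivity, ?_⟩
  intro w g H hw hEq a r x0 x1 ha hr hr4 hsub hx1 hct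
  have ha0 : 0 < a := by linarith
  obtain ⟨z1, hz1, hz1'⟩ := hstep w g H hw hEq a r x0 x1 ha hr hsub hx1 hct
  set S := Ct w g (C * a) ∩ ball x0 (r / 8) with hS
  have hSm : MeasurableSet S := (Ct_closed hw _).measurableSet.inter measurableSet_ball
  have hball : ball x0 (r / 8) ⊆ ball 0 10 := by
    have h1 : ball x0 (2 * r) ⊆ interior (closedBall 0 10) :=
      interior_maximal (ball_subset_closedBall.trans hsub) isOpen_ball
    rw [interior_closedBall _ (by norm_num)] at h1
    exact (ball_subset_ball (by linarith)).trans h1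
  set T : Eu d → Eu d := fun z => z + (1 / (m * a)) • (g z - g x1 + a • (z - x1)) with hT
  set T' : Eu d → Eu d →L[ℝ] Eu d := fun z =>
    ContinuousLinearMap.id ℝ (Eu d) + (1 / (m * a)) • (H z + a • ContinuousLinearMap.id ℝ (Eu d)) with hT'
  have hTd : ∀ z, HasFDerivAt T (T' z) z := by
    intro z
    have h1 : HasFDerivAt (fun z : Eu d => z - x1) (ContinuousLinearMap.id ℝ (Eu d)) z :=
      (hasFDerivAt_id z).sub_const x1
    have h2 : HasFDerivAt (fun z => g z - g x1 + a • (z - x1)) (H z + a • ContinuousLinearMap.id ℝ (Eu d)) z :=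
      ((hw.d2 z).sub_const (g x1)).add (h1.const_smul a)
    have h3 : HasFDerivAt (fun z => (1 / (m * a)) • (g z - g x1 + a • (z - x1)))
      ((1 / (m * a)) • (H z + a • ContinuousLinearMap.id ℝ (Eu d))) z := h2.const_smul (1 / (m * a))
    exact (hasFDerivAt_id z).add h3
  have hdet : ∀ z ∈ S, |(T' z).det| ≤ C3 ^ d := by
    rintro z ⟨hz, hzb⟩
    refine (abs_det_le _).trans (pow_le_pow_left₀ (norm_nonneg _) ?_ d)
    have hlow := Ct_hess hw (C * a) z hz (hball hzb)
    obtain ⟨A, hA, hA1⟩ := hEq z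
    have hup := hess_upper hν hA (H z) (C * a) 1 (by positivity) hlow hA1
    have hHn : ‖H z‖ ≤ C4 * a := by
      refine opnorm_of_quad (H z) (hw.symm z) _ (by positivity) fun ξ => ?_
      have h3 : (1 + C * a * (d * ν⁻¹)) / ν ≤ a * ((1 + C * D) / ν) := by
        rw [mul_div_assoc', div_le_div_iff_of_pos_right hν, ← hD]; nlinarith
      have h4 : 0 ≤ (1 + C * D) / ν := by positivity
      rw [abs_le]
      have h5 := mul_le_mul_of_nonneg_right h3 (sq_nonneg ‖ξ‖)
      have h6 := hlow ξ
      have h7 := hup ξ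
      have h8 : C4 * a * ‖ξ‖ ^ 2 = C * a * ‖ξ‖ ^ 2 + a * ((1 + C * D) / ν) * ‖ξ‖ ^ 2 := by
        rw [hC4]; ring
      have h9 : 0 ≤ C * a * ‖ξ‖ ^ 2 := by positivity
      have h10 : 0 ≤ a * ((1 + C * D) / ν) * ‖ξ‖ ^ 2 := by positivity
      constructor <;> linarith
    have hid : ‖ContinuousLinearMap.id ℝ (Eu d)‖ ≤ 1 := ContinuousLinearMap.norm_id_le
    calc ‖T' z‖ ≤ ‖ContinuousLinearMap.id ℝ (Eu d)‖ + ‖(1 / (m * a)) • (H z + a • ContinuousLinearMap.id ℝ (Eu d))‖ :=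
          norm_add_le _ _
      _ ≤ 1 + (1 / (m * a)) * (C4 * a + a * 1) := by
          rw [norm_smul, Real.norm_of_nonneg (by positivity)]
          gcongr
          refine (norm_add_le _ _).trans ?_
          rw [norm_smul, Real.norm_of_nonneg ha0.le]
          gcongr
      _ = C3 := by rw [hC3]; field_simp
  have himg : closedBall x0 (r / 64) ⊆ T '' S := by
    intro y hy
    set Ψ : Eu d → ℝ := fun z' => w z' + a / 2 * ‖z' - x1‖ ^ 2 + m * a / 2 * ‖z' - y‖ ^ 2
      - inner ℝ (g x1) (z' - x1) with hΨ
    have hΨc : Continuous Ψ := by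
      have := hw.cw
      rw [hΨ]; fun_prop
    obtain ⟨z, hzmem, hzmin⟩ := (isCompact_closedBall (0 : Eu d) 10).exists_isMinOn
      ⟨z1, hsub (closedBall_subset_closedBall (by linarith) hz1)⟩ hΨc.continuousOn
    have hmin1 : Ψ z ≤ Ψ z1 := hzmin (hsub (closedBall_subset_closedBall (by linarith) hz1))
    have hP := hct.2.2 z hzmem
    have hz1y : ‖z1 - y‖ ≤ 5 * r / 64 := by
      rw [mem_closedBall] at hz1 hy
      rw [← dist_eq_norm]
      linarith [dist_triangle_right z1 y x0]
    have hz1y2 : ‖z1 - y‖ ^ 2 ≤ (5 * r / 64) ^ 2 := pow_le_pow_left₀ (norm_nonneg _) hz1y 2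
    have hA : w z - (w x1 + inner ℝ (g x1) (z - x1) - a / 2 * ‖z - x1‖ ^ 2)
        + m * a / 2 * ‖z - y‖ ^ 2 ≤ C1 * a * r ^ 2 + m * a / 2 * (5 * r / 64) ^ 2 := by
      simp only [hΨ] at hmin1
      have := mul_le_mul_of_nonneg_left hz1y2 (show 0 ≤ m * a / 2 by positivity)
      linarith
    have hzy : ‖z - y‖ ^ 2 < (7 * r / 64) ^ 2 := by
      have h1 : m * a / 2 * ‖z - y‖ ^ 2 ≤ C1 * a * r ^ 2 + m * a / 2 * (5 * r / 64) ^ 2 := by linarith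
      have h2 : C1 * a * r ^ 2 + m * a / 2 * (5 * r / 64) ^ 2 < m * a / 2 * (7 * r / 64) ^ 2 := by
        rw [hm]
        have : 0 < C1 * a * r ^ 2 := by positivity
        nlinarith
      exact lt_of_mul_lt_mul_left (h1.trans_lt h2) (by positivity)
    have hzy' : ‖z - y‖ < 7 * r / 64 := lt_of_pow_lt_pow_left₀ 2 (by positivity) hzy
    have hzx0 : z ∈ ball x0 (r / 8) := by
      rw [mem_closedBall] at hy
      rw [← dist_eq_norm] at hzy'
      rw [mem_ball]
      linarith [dist_triangle z y x0]
    have hloc : IsLocalMin Ψ z :=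
      hzmin.isLocalMin (mem_of_superset (isOpen_ball.mem_nhds (hball hzx0)) ball_subset_closedBall)
    have hg := min_grad hw z x1 y (g x1) (a / 2) (m * a / 2) hloc
    have hzx1 : ‖z - x1‖ ≤ 2 * r := by
      rw [mem_ball] at hzx0
      rw [← dist_eq_norm]
      linarith [dist_triangle_right z x1 x0]
    refine ⟨z, ⟨⟨?_, ?_, ?_⟩, hzx0⟩, ?_⟩
    · rw [hg]
      have e1 : ‖(2 * (a / 2)) • (z - x1)‖ = a * ‖z - x1‖ := by
        rw [norm_smul, Real.norm_of_nonneg (by positivity)]; ring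
      have e2 : ‖(2 * (m * a / 2)) • (z - y)‖ = m * a * ‖z - y‖ := by
        rw [norm_smul, Real.norm_of_nonneg (by positivity)]; ring
      have h1 := norm_sub_le (g x1 - (2 * (a / 2)) • (z - x1)) ((2 * (m * a / 2)) • (z - y))
      have h2 := norm_sub_le (g x1) ((2 * (a / 2)) • (z - x1))
      rw [e2] at h1
      rw [e1] at h2
      have h3 := hct.1
      have h4 : a * ‖z - x1‖ ≤ a * 8 := by gcongr; linarith
      have h5 : m * a * ‖z - y‖ ≤ m * a * 4 := by gcongr; linarith
      have h6 : 0 ≤ 16 * (C1 + m) * a := by positivity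
      rw [hC]; linarith
    · have h1 : inner ℝ (g x1) (z - x1) ≤ a * 8 := by
        refine (real_inner_le_norm _ _).trans ?_
        have := hct.1
        gcongr; linarith
      have h2 : 0 ≤ m * a / 2 * ‖z - y‖ ^ 2 := by positivity
      have h3 := hct.2.1
      have h4 : r ^ 2 ≤ 16 := by nlinarith
      have h5 : C1 * a * r ^ 2 ≤ C1 * a * 16 := by gcongr
      have h6 : m * a / 2 * (5 * r / 64) ^ 2 ≤ m * a * 16 := by
        have : (5 * r / 64) ^ 2 ≤ 16 := by nlinarith
        nlinarith [mul_pos hm0 ha0]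
      have h7 : 0 ≤ a / 2 * ‖z - x1‖ ^ 2 := by positivity
      have h8 : 0 ≤ 4 * m * a := by positivity
      rw [hC]; linarith
    · intro z' hz'
      have h1 : Ψ z ≤ Ψ z' := hzmin hz'
      simp only [hΨ] at h1
      set η := z' - z with hη
      have e1 : z' - x1 = (z - x1) + (1 : ℝ) • η := by rw [hη, one_smul]; abel
      have e2 : z' - y = (z - y) + (1 : ℝ) • η := by rw [hη, one_smul]; abel
      rw [e1, e2, norm_line_sq, norm_line_sq, inner_add_right, inner_smul_right] at h1
      have e3 : inner ℝ (g z) η = inner ℝ (g x1) η - a * inner ℝ (z - x1) η - m * a * inner ℝ (z - y) η := by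
        rw [hg]; simp only [inner_sub_left, inner_smul_left, conj_trivial]; ring
      rw [e3]
      have h2 : (1 + m) * a / 2 * ‖η‖ ^ 2 ≤ C * a / 2 * ‖η‖ ^ 2 := by
        gcongr
        rw [hC]; linarith
      linarith
    · simp only [hT]
      have : g z - g x1 + a • (z - x1) = (m * a) • (y - z) := by
        rw [hg]; module
      rw [this, smul_smul]
      have : 1 / (m * a) * (m * a) = 1 := by field_simp
      rw [this, one_smul]; abel
  have hvol : volume (closedBall x0 (r / 64)) ≤ ENNReal.ofReal (C3 ^ d) * volume S := by
    calc volume (closedBall x0 (r / 64)) ≤ volume (T '' S) := measure_mono himg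
      _ ≤ ∫⁻ z in S, ENNReal.ofReal |(T' z).det| :=
          MeasureTheory.addHaar_image_le_lintegral_abs_det_fderiv volume hSm
            fun z _ => (hTd z).hasFDerivWithinAt
      _ ≤ ∫⁻ z in S, ENNReal.ofReal (C3 ^ d) :=
          setLIntegral_mono measurable_const fun z hz => ENNReal.ofReal_le_ofReal (hdet z hz)
      _ = _ := by simp
  have e8 : volume (closedBall x0 (r / 8)) = ENNReal.ofReal (8 ^ d) * volume (closedBall x0 (r / 64)) := by
    rw [Measure.addHaar_closedBall _ _ (by positivity), Measure.addHaar_closedBall _ _ (by positivity),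
      ← mul_assoc, ← ENNReal.ofReal_mul (by positivity)]
    congr 2
    rw [finrank_euclideanSpace_fin, ← mul_pow]
    congr 1; ring
  calc ENNReal.ofReal (1 / (8 ^ d * C3 ^ d)) * volume (closedBall x0 (r / 8))
      ≤ ENNReal.ofReal (1 / (8 ^ d * C3 ^ d)) * (ENNReal.ofReal (8 ^ d) * (ENNReal.ofReal (C3 ^ d) * volume S)) := by
        rw [e8]; gcongr
    _ = volume S := by
        rw [← mul_assoc, ← mul_assoc, ← ENNReal.ofReal_mul (by positivity), ← ENNReal.ofReal_mul (by positivity)]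
        have : 1 / (8 ^ d * C3 ^ d) * 8 ^ d * C3 ^ d = 1 := by field_simp
        rw [this]; simp
/-! ### Covering and measure decay -/

theorem vit (d : ℕ) (ν : ℝ) (hν : 0 < ν) : ∃ C θ : ℝ, 1 ≤ C ∧ 0 < θ ∧ θ < 1 ∧
    ∀ (w : Eu d → ℝ) (g : Eu d → Eu d) (H : Eu d → Eu d →L[ℝ] Eu d), C2 w g H →
    (∀ x, ∃ A, Ell d ν A ∧ trA A (H x) ≤ 1) →
    ∀ (a : ℝ), 1 ≤ a → (Ct w g a ∩ ball 0 1).Nonempty →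
    volume.real (ball 0 1 \ Ct w g (C * a)) ≤ (1 - θ) * volume.real (ball 0 1 \ Ct w g a) := by
  obtain ⟨C, c, hC, hc, hml⟩ := mainlem d ν hν
  refine ⟨C, min (c / 5 ^ d) (1 / 2), hC, by positivity, (min_le_right _ _).trans_lt (by norm_num), ?_⟩
  intro w g H hw hEq a ha hne
  set S := Ct w g a with hS
  set S' := Ct w g (C * a) with hS'
  set D := ball (0 : Eu d) 1 \ S with hD
  have hSc : IsClosed S := Ct_closed hw a
  have hSS' : S ⊆ S' := Ct_mono w g (by nlinarith)
  have hDm : MeasurableSet D := measurableSet_ball.diff hSc.measurableSet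
  have hS'm : MeasurableSet S' := (Ct_closed hw _).measurableSet
  have hDfin : volume D ≠ ⊤ :=
    ((measure_mono sdiff_subset).trans_lt measure_ball_lt_top).ne
  obtain ⟨p0, hp0, hp0b⟩ := hne
  set ρ : Eu d → ℝ := fun x => infDist x S with hρ
  set X : Eu d → Eu d := fun x => (1 - ρ x / 4) • x with hX
  have hρpos : ∀ x ∈ D, 0 < ρ x := fun x hx =>
    (hSc.notMem_iff_infDist_pos ⟨p0, hp0⟩).1 hx.2
  have hρ2 : ∀ x ∈ D, ρ x < 2 := by
    intro x hx
    have h1 : ρ x ≤ dist x p0 := infDist_le_dist_of_mem hp0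
    have h2 := hx.1
    rw [mem_ball] at h2 hp0b
    linarith [dist_triangle_right x p0 0]
  have hdX : ∀ x ∈ D, dist x (X x) ≤ ρ x / 4 := by
    intro x hx
    have h1 := hρpos x hx
    have h2 := hx.1
    rw [mem_ball_zero_iff] at h2
    have : x - X x = (ρ x / 4) • x := by simp only [hX]; module
    rw [dist_eq_norm, this, norm_smul, Real.norm_of_nonneg (by positivity)]
    nlinarith
  have hXn : ∀ x ∈ D, ‖X x‖ ≤ 1 - ρ x / 4 := by
    intro x hx
    have h1 := hρ2 x hx
    have h2 := hx.1
    rw [mem_ball_zero_iff] at h2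
    simp only [hX]
    rw [norm_smul, Real.norm_of_nonneg (by linarith)]
    nlinarith
  have hballD : ∀ x ∈ D, ball (X x) (ρ x / 4) ⊆ D := by
    intro x hx y hy
    rw [mem_ball] at hy
    constructor
    · rw [mem_ball]
      have := hXn x hx
      rw [← dist_zero_right] at this
      linarith [dist_triangle y (X x) 0]
    · intro hyS
      have h1 : ρ x ≤ dist x y := infDist_le_dist_of_mem hyS
      have h2 := hdX x hx
      have h3 := hρpos x hx
      linarith [dist_triangle_right x y (X x)]
  have hmeas : ∀ x ∈ D, ENNReal.ofReal c * volume (closedBall (X x) (ρ x / 4)) ≤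
      volume (S' ∩ ball (X x) (ρ x / 4)) := by
    intro x hx
    obtain ⟨p, hp, hpd⟩ := hSc.exists_infDist_eq_dist ⟨p0, hp0⟩ x
    have h1 := hρpos x hx
    have h2 := hρ2 x hx
    have h3 := hdX x hx
    have h4 := hXn x hx
    have := hml w g H hw hEq a (2 * ρ x) (X x) p ha (by linarith) (by linarith) ?_ ?_ hp
    · have e : 2 * ρ x / 8 = ρ x / 4 := by ring
      rwa [e] at this
    · apply closedBall_subset_closedBall'
      rw [dist_zero_right]; linarith
    · have h5 : dist x p = ρ x := hpd.symm
      linarith [dist_triangle_left p (X x) x]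
  obtain ⟨U, hUD, hUdis, hUcov⟩ := Vitali.exists_disjoint_subfamily_covering_enlargement_closedBall
    D X (fun x => ρ x / 4) (1 / 2) (fun x hx => by have := hρ2 x hx; linarith) 5 (by norm_num)
  have hUdis' : U.PairwiseDisjoint fun x => S' ∩ ball (X x) (ρ x / 4) :=
    hUdis.mono_on fun x _ => inter_subset_right.trans ball_subset_closedBall
  have hUc : U.Countable := by
    refine hUdis.countable_of_nonempty_interior fun x hx => ?_
    refine ⟨X x, ball_subset_interior_closedBall (mem_ball_self ?_)⟩
    have := hρpos x (hUD hx); positivity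
  have hkey : ENNReal.ofReal (c / 5 ^ d) * volume D ≤ volume (S' ∩ D) := by
    have hcov : D ⊆ ⋃ b ∈ U, closedBall (X b) (5 * (ρ b / 4)) := by
      intro x hx
      obtain ⟨b, hb, hsub⟩ := hUcov x hx
      exact mem_biUnion hb (hsub (by rw [mem_closedBall]; exact hdX x hx))
    have h5 : ∀ b ∈ U, volume (closedBall (X b) (5 * (ρ b / 4))) =
        ENNReal.ofReal (5 ^ d) * volume (closedBall (X b) (ρ b / 4)) := by
      intro b hb
      have := hρpos b (hUD hb)
      rw [Measure.addHaar_closedBall _ _ (by positivity), Measure.addHaar_closedBall _ _ (by positivity),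
        ← mul_assoc, ← ENNReal.ofReal_mul (by positivity)]
      congr 2
      rw [finrank_euclideanSpace_fin, ← mul_pow]
    calc ENNReal.ofReal (c / 5 ^ d) * volume D
        ≤ ENNReal.ofReal (c / 5 ^ d) * volume (⋃ b ∈ U, closedBall (X b) (5 * (ρ b / 4))) := by
          gcongr
      _ ≤ ENNReal.ofReal (c / 5 ^ d) * ∑' b : U, volume (closedBall (X b) (5 * (ρ b / 4))) := by
          gcongr; exact measure_biUnion_le _ hUc _
      _ = ∑' b : U, ENNReal.ofReal c * volume (closedBall (X b) (ρ b / 4)) := by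
          rw [← ENNReal.tsum_mul_left]
          congr 1; ext b
          rw [h5 b b.2, ← mul_assoc, ← ENNReal.ofReal_mul (by positivity)]
          congr 2; field_simp
      _ ≤ ∑' b : U, volume (S' ∩ ball (X b) (ρ b / 4)) :=
          ENNReal.tsum_le_tsum fun b => hmeas b (hUD b.2)
      _ = volume (⋃ b ∈ U, S' ∩ ball (X b) (ρ b / 4)) :=
          (measure_biUnion hUc hUdis' fun b _ => hS'm.inter measurableSet_ball).symm
      _ ≤ volume (S' ∩ D) := by
          apply measure_mono
          exact iUnion₂_subset fun b hb => inter_subset_inter_right _ (hballD b (hUD hb))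
  have hkey' : c / 5 ^ d * volume.real D ≤ volume.real (S' ∩ D) := by
    have h1 := ENNReal.toReal_mono ((measure_mono inter_subset_right).trans_lt hDfin.lt_top).ne hkey
    rwa [ENNReal.toReal_mul, ENNReal.toReal_ofReal (by positivity)] at h1
  have e1 : ball (0 : Eu d) 1 \ S' = D \ S' := by
    ext y; simp only [hD, Set.mem_sdiff]
    constructor
    · rintro ⟨h, h'⟩; exact ⟨⟨h, fun hh => h' (hSS' hh)⟩, h'⟩
    · rintro ⟨⟨h, _⟩, h'⟩; exact ⟨h, h'⟩
  have e2 : volume.real (D ∩ S') + volume.real (D \ S') = volume.real D :=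
    measureReal_inter_add_sdiff hS'm hDfin
  rw [inter_comm] at e2
  rw [e1]
  have h3 : min (c / 5 ^ d) (1 / 2) * volume.real D ≤ c / 5 ^ d * volume.real D := by
    gcongr; exact min_le_left _ _
  linarith

theorem initial {d : ℕ} {w : Eu d → ℝ} {g : Eu d → Eu d} {H : Eu d → Eu d →L[ℝ] Eu d}
    (hw : C2 w g H) (h0 : ∀ x ∈ closedBall (0 : Eu d) 10, 0 ≤ w x) (x1 : Eu d)
    (hx1 : ‖x1‖ ≤ 1 / 2) (hw1 : w x1 ≤ 1 / 2) : (Ct w g 8 ∩ ball 0 1).Nonempty := by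
  have hwc := hw.cw
  have hΨc : Continuous (fun z' => w z' + 4 * ‖z' - x1‖ ^ 2 + 0 * ‖z' - 0‖ ^ 2
      - inner ℝ (0 : Eu d) (z' - x1)) := by fun_prop
  have hx1m : x1 ∈ closedBall (0 : Eu d) 10 := by rw [mem_closedBall_zero_iff]; linarith
  obtain ⟨z, hzm, hzmin⟩ := (isCompact_closedBall (0 : Eu d) 10).exists_isMinOn ⟨x1, hx1m⟩ hΨc.continuousOn
  have h1 := hzmin hx1m
  simp at h1
  have hz0 := h0 z hzm
  have hzx : ‖z - x1‖ < 1 / 2 := by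
    by_contra hh
    push Not at hh
    nlinarith
  have hz1 : ‖z‖ < 1 := by
    have := norm_add_le (z - x1) x1
    rw [sub_add_cancel] at this
    linarith
  have hloc : IsLocalMin (fun z' => w z' + 4 * ‖z' - x1‖ ^ 2 + 0 * ‖z' - 0‖ ^ 2
      - inner ℝ (0 : Eu d) (z' - x1)) z :=
    hzmin.isLocalMin (closedBall_mem_nhds_of_mem (by rw [mem_ball_zero_iff]; linarith))
  have hg := min_grad hw z x1 0 0 4 0 hloc
  have hg' : g z = (-8 : ℝ) • (z - x1) := by rw [hg]; module
  refine ⟨z, ⟨?_, ?_, ?_⟩, by rw [mem_ball_zero_iff]; exact hz1⟩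
  · rw [hg', norm_smul]; norm_num; linarith
  · nlinarith [sq_nonneg ‖z - x1‖]
  · intro z' hz'
    have h2 := hzmin hz'
    simp at h2
    have e1 : z' - x1 = (z - x1) + (1 : ℝ) • (z' - z) := by rw [one_smul]; abel
    rw [e1, norm_line_sq] at h2
    rw [hg', inner_smul_left]
    simp
    linarith

theorem small_level (d : ℕ) (ν : ℝ) (hν : 0 < ν) : ∃ M : ℝ, 1 ≤ M ∧
    ∀ (w : Eu d → ℝ) (g : Eu d → Eu d) (H : Eu d → Eu d →L[ℝ] Eu d), C2 w g H →
    (∀ x, ∃ A, Ell d ν A ∧ trA A (H x) ≤ 1) →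
    (∀ x ∈ closedBall (0 : Eu d) 10, 0 ≤ w x) →
    (∃ x1, ‖x1‖ ≤ 1 / 2 ∧ w x1 ≤ 1 / 2) →
    volume.real (ball (0 : Eu d) 1 ∩ {x | M < w x}) < 1 / 2 * volume.real (ball (0 : Eu d) 1) := by
  obtain ⟨C, θ, hC, hθ, hθ1, hv⟩ := vit d ν hν
  have hV : 0 < volume.real (ball (0 : Eu d) 1) :=
    ENNReal.toReal_pos (measure_ball_pos _ _ (by norm_num)).ne' measure_ball_lt_top.ne
  obtain ⟨n, hn⟩ := exists_pow_lt_of_lt_one (show (0 : ℝ) < 1 / 2 by norm_num) (show 1 - θ < 1 by linarith)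
  refine ⟨C ^ n * 8, by have := one_le_pow₀ hC (n := n); linarith, ?_⟩
  rintro w g H hw hEq h0 ⟨x1, hx1, hw1⟩
  have hin := initial hw h0 x1 hx1 hw1
  have hk : ∀ k : ℕ, volume.real (ball (0 : Eu d) 1 \ Ct w g (C ^ k * 8)) ≤
      (1 - θ) ^ k * volume.real (ball (0 : Eu d) 1) := by
    intro k
    induction k with
    | zero => simp; exact measureReal_mono sdiff_subset measure_ball_lt_top.ne
    | succ k ih =>
      have h1 := one_le_pow₀ hC (n := k)
      have := hv w g H hw hEq (C ^ k * 8) (by linarith)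
        (hin.mono (inter_subset_inter_left _ (Ct_mono w g (by linarith))))
      rw [pow_succ', pow_succ', mul_assoc, mul_assoc]
      refine this.trans ?_
      gcongr
  calc _ ≤ volume.real (ball (0 : Eu d) 1 \ Ct w g (C ^ n * 8)) := by
        refine measureReal_mono ?_ ((measure_mono sdiff_subset).trans_lt measure_ball_lt_top).ne
        rintro x ⟨hx, hx'⟩
        refine ⟨hx, fun h => ?_⟩
        have := h.2.1
        simp only [mem_ofPred_eq] at hx'
        linarith
    _ ≤ _ := hk n
    _ < _ := by gcongr

theorem C2.smul_add {d : ℕ} {w : Eu d → ℝ} {g : Eu d → Eu d} {H : Eu d → Eu d →L[ℝ] Eu d}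
    (hw : C2 w g H) (c b : ℝ) : C2 (fun x => c * w x + b) (fun x => c • g x) (fun x => c • H x) where
  d1 x := by
    have := ((hw.d1 x).const_mul c).add_const b
    refine this.congr_fderiv ?_
    ext y; simp [inner_smul_left]
  d2 x := (hw.d2 x).const_smul c

theorem C2.scale {d : ℕ} {w : Eu d → ℝ} {g : Eu d → Eu d} {H : Eu d → Eu d →L[ℝ] Eu d}
    (hw : C2 w g H) (x0 : Eu d) (l : ℝ) : C2 (fun x => w (x0 + l • x)) (fun x => l • g (x0 + l • x))
      (fun x => (l ^ 2) • H (x0 + l • x)) where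
  d1 x := by
    have hl : HasFDerivAt (fun x : Eu d => x0 + l • x) (l • ContinuousLinearMap.id ℝ (Eu d)) x :=
      ((hasFDerivAt_id x).const_smul l).const_add x0
    have := (hw.d1 (x0 + l • x)).comp x hl
    refine this.congr_fderiv ?_
    ext y; simp [inner_smul_left, inner_smul_right]
  d2 x := by
    have hl : HasFDerivAt (fun x : Eu d => x0 + l • x) (l • ContinuousLinearMap.id ℝ (Eu d)) x :=
      ((hasFDerivAt_id x).const_smul l).const_add x0
    have := ((hw.d2 (x0 + l • x)).comp x hl).const_smul l
    refine this.congr_fderiv ?_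
    ext1 y; simp [smul_smul, pow_two]

theorem osc (d : ℕ) (ν : ℝ) (hν : 0 < ν) : ∃ M : ℝ, 1 ≤ M ∧
    ∀ (w : Eu d → ℝ) (g : Eu d → Eu d) (H : Eu d → Eu d →L[ℝ] Eu d) (F : ℝ), C2 w g H →
    (∀ x, ∃ A, Ell d ν A ∧ |trA A (H x)| ≤ F) → ∀ (m ω : ℝ), 0 < ω → 4 * M * F ≤ ω →
    (∀ x ∈ closedBall (0 : Eu d) 10, m ≤ w x ∧ w x ≤ m + ω) →
    ∃ m', ∀ x ∈ closedBall (0 : Eu d) (1 / 2), m' ≤ w x ∧ w x ≤ m' + (1 - 1 / (8 * M)) * ω := by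
  obtain ⟨M, hM, hs⟩ := small_level d ν hν
  refine ⟨M, hM, ?_⟩
  intro w g H F hw hEq m ω hω hF hb
  have hM0 : 0 < M := by linarith
  set c : ℝ := 4 * M / ω with hc
  have hc0 : 0 < c := by positivity
  have hcω : c * ω = 4 * M := by rw [hc]; field_simp
  have hcF : c * F ≤ 1 := by
    have : c * (4 * M * F) ≤ c * ω := by gcongr
    rw [hcω] at this
    have h4 : 0 < 4 * M := by linarith
    by_contra hh
    push Not at hh
    nlinarith
  by_contra hcon
  push Not at hcon
  have hV : 0 < volume.real (ball (0 : Eu d) 1) :=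
    ENNReal.toReal_pos (measure_ball_pos _ _ (by norm_num)).ne' measure_ball_lt_top.ne
  have h8 : c * (1 / (8 * M) * ω) = 1 / 2 := by
    rw [hc]; field_simp; norm_num
  have hlow : volume.real (ball (0 : Eu d) 1 ∩ {x | M < c * w x + (-(c * m))}) < 1 / 2 * volume.real (ball (0 : Eu d) 1) := by
    refine hs _ _ _ (hw.smul_add c (-(c * m))) ?_ ?_ ?_
    · intro x
      obtain ⟨A, hA, hA1⟩ := hEq x
      refine ⟨A, hA, ?_⟩
      rw [trA_smul]
      have := (abs_le.1 hA1).2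
      nlinarith
    · intro x hx
      have := (hb x hx).1
      nlinarith
    · by_contra hno
      push Not at hno
      obtain ⟨x, hx, hx'⟩ := hcon (m + 1 / (8 * M) * ω)
      have hx10 : x ∈ closedBall (0 : Eu d) 10 := closedBall_subset_closedBall (by norm_num) hx
      have := hx' ?_
      · have := (hb x hx10).2
        linarith
      · have := hno x (by rwa [mem_closedBall_zero_iff] at hx)
        have : c * (m + 1 / (8 * M) * ω) < c * w x := by rw [mul_add, h8]; linarith
        exact (lt_of_mul_lt_mul_left this hc0.le).le
  have hupp : volume.real (ball (0 : Eu d) 1 ∩ {x | M < (-c) * w x + (c * (m + ω))}) < 1 / 2 * volume.real (ball (0 : Eu d) 1) := by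
    refine hs _ _ _ (hw.smul_add (-c) (c * (m + ω))) ?_ ?_ ?_
    · intro x
      obtain ⟨A, hA, hA1⟩ := hEq x
      refine ⟨A, hA, ?_⟩
      rw [trA_smul]
      have := (abs_le.1 hA1).1
      nlinarith
    · intro x hx
      have := (hb x hx).2
      nlinarith
    · by_contra hno
      push Not at hno
      obtain ⟨x, hx, hx'⟩ := hcon m
      have hx10 : x ∈ closedBall (0 : Eu d) 10 := closedBall_subset_closedBall (by norm_num) hx
      have h1 := hx' (hb x hx10).1
      have h2 := hno x (by rwa [mem_closedBall_zero_iff] at hx)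
      have h3 : c * (m + (1 - 1 / (8 * M)) * ω) < c * w x := by gcongr
      have h4 : c * (m + (1 - 1 / (8 * M)) * ω) = c * (m + ω) - 1 / 2 := by rw [← h8]; ring
      linarith
  have hcov : ball (0 : Eu d) 1 ⊆ (ball (0 : Eu d) 1 ∩ {x | M < c * w x + (-(c * m))}) ∪
      (ball (0 : Eu d) 1 ∩ {x | M < (-c) * w x + (c * (m + ω))}) := by
    intro x hx
    by_cases h : M < c * w x + (-(c * m))
    · exact Or.inl ⟨hx, h⟩
    · refine Or.inr ⟨hx, ?_⟩
      simp only [mem_ofPred_eq]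
      rw [mul_add, hcω]; linarith
  have h1 := (measureReal_mono (μ := volume) hcov (by
    refine ((measure_mono (union_subset inter_subset_left inter_subset_left)).trans_lt
      (measure_ball_lt_top (x := (0 : Eu d)) (r := 1))).ne)).trans (measureReal_union_le _ _)
  linarith

theorem small_osc0 (d : ℕ) (ν : ℝ) (hν : 0 < ν) : ∃ F0 r0 : ℝ, 0 < F0 ∧ 0 < r0 ∧
    ∀ (w : Eu d → ℝ) (g : Eu d → Eu d) (H : Eu d → Eu d →L[ℝ] Eu d), C2 w g H →
    (∀ x, ∃ A, Ell d ν A ∧ |trA A (H x)| ≤ F0) → (∀ x, 0 ≤ w x ∧ w x ≤ 1) →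
    ∀ x, ‖x‖ ≤ r0 → |w x - w 0| ≤ 1 / 16 := by
  obtain ⟨M, hM, ho⟩ := osc d ν hν
  have hM0 : 0 < M := by linarith
  have hθ : 0 < 1 / (8 * M) := by positivity
  have hθ1 : 1 / (8 * M) ≤ 1 / 8 := by
    apply one_div_le_one_div_of_le <;> linarith
  set q : ℝ := 1 - 1 / (8 * M) with hq
  obtain ⟨n, hn⟩ := exists_pow_lt_of_lt_one (show (0 : ℝ) < 1 / 16 by norm_num) (show q < 1 by linarith)
  refine ⟨1 / (64 * M), 10 * (1 / 20) ^ n, by positivity, by positivity, ?_⟩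
  intro w g H hw hEq hb
  have hk : ∀ k : ℕ, ∃ m, ∀ x ∈ closedBall (0 : Eu d) 10,
      m ≤ w (0 + ((1 / 20 : ℝ) ^ k) • x) ∧ w (0 + ((1 / 20 : ℝ) ^ k) • x) ≤ m + max (1 / 16) (q ^ k) := by
    intro k
    induction k with
    | zero =>
      refine ⟨0, fun x _ => ⟨(hb _).1, (hb _).2.trans ?_⟩⟩
      rw [pow_zero, zero_add]; exact le_max_right _ _
    | succ k ih =>
      obtain ⟨m, hm⟩ := ih
      obtain ⟨m', hm'⟩ := ho _ _ _ (1 / (64 * M)) (hw.scale 0 ((1 / 20 : ℝ) ^ k)) (by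
        intro x
        obtain ⟨A, hA, hA1⟩ := hEq (0 + ((1 / 20 : ℝ) ^ k) • x)
        refine ⟨A, hA, ?_⟩
        rw [trA_smul, abs_mul, abs_of_nonneg (by positivity)]
        have h1 : ((1 / 20 : ℝ) ^ k) ^ 2 ≤ 1 :=
          pow_le_one₀ (by positivity) (pow_le_one₀ (by norm_num) (by norm_num))
        have h2 := abs_nonneg (trA A (H (0 + ((1 / 20 : ℝ) ^ k) • x)))
        nlinarith) m (max (1 / 16) (q ^ k)) (lt_max_of_lt_left (by norm_num)) (by
        refine le_trans (le_of_eq ?_) (le_max_left _ _)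
        field_simp; norm_num) hm
      refine ⟨m', fun x hx => ?_⟩
      have hx' : (1 / 20 : ℝ) • x ∈ closedBall (0 : Eu d) (1 / 2) := by
        rw [mem_closedBall_zero_iff] at hx ⊢
        rw [norm_smul]; norm_num; linarith
      have h1 := hm' _ hx'
      have e : ((1 / 20 : ℝ) ^ k) • ((1 / 20 : ℝ) • x) = ((1 / 20 : ℝ) ^ (k + 1)) • x := by
        rw [smul_smul, pow_succ]
      simp only [e] at h1
      refine ⟨h1.1, h1.2.trans ?_⟩
      gcongr
      rw [mul_max_of_nonneg _ _ (by linarith), ← pow_succ']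
      apply max_le_max _ le_rfl
      linarith
  obtain ⟨m, hm⟩ := hk n
  rw [max_eq_left hn.le] at hm
  intro x hx
  have h0 := hm 0 (by simp)
  have h1 := hm ((20 : ℝ) ^ n • x) (by
    rw [mem_closedBall_zero_iff, norm_smul, norm_pow]
    norm_num
    calc (20 : ℝ) ^ n * ‖x‖ ≤ 20 ^ n * (10 * (1 / 20) ^ n) := by gcongr
      _ = 10 := by rw [one_div, inv_pow]; field_simp)
  have e : ((1 / 20 : ℝ) ^ n) • ((20 : ℝ) ^ n • x) = x := by
    rw [smul_smul, ← mul_pow]; norm_num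
  rw [e] at h1
  simp at h0 h1
  rw [abs_le]; constructor <;> linarith

theorem small_osc (d : ℕ) (ν : ℝ) (hν : 0 < ν) : ∃ F0 r0 : ℝ, 0 < F0 ∧ 0 < r0 ∧
    ∀ (w : Eu d → ℝ) (g : Eu d → Eu d) (H : Eu d → Eu d →L[ℝ] Eu d) (G L l : ℝ), 0 < L → 0 < l →
    C2 w g H → (∀ x, ∃ A, Ell d ν A ∧ |trA A (H x)| ≤ G) → (∀ x, 0 ≤ w x ∧ w x ≤ 2 * L) →
    l ^ 2 * G ≤ 2 * L * F0 →
    ∀ x0 x, ‖x - x0‖ ≤ r0 * l → |w x - w x0| ≤ L / 8 := by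
  obtain ⟨F0, r0, hF0, hr0, h⟩ := small_osc0 d ν hν
  refine ⟨F0, r0, hF0, hr0, ?_⟩
  intro w g H G L l hL hl hw hEq hb hlG x0 x hx
  have h1 := h _ _ _ ((hw.scale x0 l).smul_add (1 / (2 * L)) 0) (by
    intro y
    obtain ⟨A, hA, hA1⟩ := hEq (x0 + l • y)
    refine ⟨A, hA, ?_⟩
    rw [trA_smul, trA_smul, abs_mul, abs_mul, abs_of_nonneg (by positivity), abs_of_nonneg (by positivity)]
    rw [one_div, inv_mul_le_iff₀ (by positivity)]
    exact le_trans (by gcongr) hlG) (by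
    intro y
    have := hb (x0 + l • y)
    constructor
    · have := this.1; positivity
    · rw [add_zero, one_div, inv_mul_le_iff₀ (by positivity)]; linarith) ((1 / l) • (x - x0)) (by
    rw [norm_smul, Real.norm_of_nonneg (by positivity), one_div, inv_mul_le_iff₀ hl]; linarith)
  have e : l • ((1 / l) • (x - x0)) = x - x0 := by rw [smul_smul]; field_simp; simp
  rw [e] at h1
  simp only [add_sub_cancel, smul_zero, add_zero, ← mul_sub] at h1
  rw [abs_mul, abs_of_nonneg (by positivity), one_div, inv_mul_le_iff₀ (by positivity)] at h1
  linarith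
/-! ### Parabolic barrier -/

structure TC {d : ℕ} (u Ut : ℝ → Eu d → ℝ) (g : ℝ → Eu d → Eu d)
    (H : ℝ → Eu d → Eu d →L[ℝ] Eu d) : Prop where
  cu : ContinuousOn (fun z : ℝ × Eu d => u z.1 z.2) (parNeg d)
  ct : ContinuousOn (fun z : ℝ × Eu d => Ut z.1 z.2) (parNeg d)
  cg : ContinuousOn (fun z : ℝ × Eu d => g z.1 z.2) (parNeg d)
  cH : ContinuousOn (fun z : ℝ × Eu d => H z.1 z.2) (parNeg d)
  dt : ∀ t, t < 0 → ∀ x, HasDerivAt (fun s => u s x) (Ut t x) t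
  dx : ∀ t, t < 0 → C2 (u t) (g t) (H t)

theorem left_deriv_nonpos {φ : ℝ → ℝ} {c t1 t : ℝ} (ht : t1 < t) (hd : HasDerivAt φ c t)
    (hmin : ∀ s ∈ Icc t1 t, φ t ≤ φ s) : c ≤ 0 := by
  have h := (hasDerivWithinAt_iff_tendsto_slope' (s := Iio t) (by simp)).1 (hd.hasDerivWithinAt (s := Iio t))
  refine le_of_tendsto h ?_
  filter_upwards [Ioo_mem_nhdsLT ht] with s hs
  rw [slope_def_field]
  apply div_nonpos_of_nonneg_of_nonpos
  · linarith [hmin s ⟨hs.1.le, hs.2.le⟩]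
  · linarith [hs.2]

theorem sq_d1 (c p0 p1 p2 s : ℝ) :
    HasDerivAt (fun s : ℝ => c * (p0 + p1 * s + p2 * s ^ 2) ^ 2)
      (c * 2 * (p0 + p1 * s + p2 * s ^ 2) * (p1 + 2 * p2 * s)) s := by
  have hq : HasDerivAt (fun s : ℝ => p0 + p1 * s + p2 * s ^ 2) (p1 + 2 * p2 * s) s := by
    have := (((hasDerivAt_id s).const_mul p1).const_add p0).add (((hasDerivAt_id s).pow 2).const_mul p2)
    refine this.congr_deriv ?_
    simp; ring
  refine ((hq.pow 2).const_mul c).congr_deriv ?_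
  simp; ring

theorem sq_d2 (c p0 p1 p2 : ℝ) :
    HasDerivAt (fun s : ℝ => c * 2 * (p0 + p1 * s + p2 * s ^ 2) * (p1 + 2 * p2 * s))
      (2 * c * (p1 ^ 2 + 2 * p0 * p2)) 0 := by
  have hq : HasDerivAt (fun s : ℝ => p0 + p1 * s + p2 * s ^ 2) p1 0 := by
    have := (((hasDerivAt_id (0 : ℝ)).const_mul p1).const_add p0).add (((hasDerivAt_id (0 : ℝ)).pow 2).const_mul p2)
    refine this.congr_deriv ?_
    simp
  have h2 : HasDerivAt (fun s : ℝ => p1 + 2 * p2 * s) (2 * p2) 0 := by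
    simpa using ((hasDerivAt_id (0 : ℝ)).const_mul (2 * p2)).const_add p1
  refine ((hq.const_mul (c * 2)).mul h2).congr_deriv ?_
  simp; ring

set_option maxHeartbeats 1000000 in
theorem barrier (d : ℕ) (ν : ℝ) (hν : 0 < ν) : ∃ lam : ℝ, 0 < lam ∧
    ∀ (v Ut : ℝ → Eu d → ℝ) (g : ℝ → Eu d → Eu d) (H : ℝ → Eu d → Eu d →L[ℝ] Eu d), TC v Ut g H →
    (∀ t < 0, ∀ x, 0 ≤ v t x) → ∀ k : ℝ, 0 ≤ k →
    (∀ t < 0, ∀ x, ∃ A, Ell d ν A ∧ -k ≤ Ut t x - trA A (H t x)) →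
    ∀ (t1 t0 : ℝ) (x0 : Eu d) (r μ : ℝ), t1 ≤ t0 → t0 < 0 → 0 < r → 0 ≤ μ →
    (∀ x, ‖x - x0‖ ≤ r → μ ≤ v t1 x) →
    μ * Real.exp (-lam * (t0 - t1) / r ^ 2) - k * (t0 - t1) ≤ v t0 x0 := by
  set D : ℝ := d * ν⁻¹ with hD
  have hD0 : 0 ≤ D := by positivity
  set lam : ℝ := (8 * ν + 4 * D) ^ 2 / (32 * ν) with hlam
  have hl : 32 * ν * lam = (8 * ν + 4 * D) ^ 2 := by rw [hlam]; field_simp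
  have hlam0 : 0 < lam := by positivity
  refine ⟨lam, hlam0, ?_⟩
  intro v Ut g H hv hv0 k hk hEq t1 t0 x0 r μ ht ht0 hr hμ hini
  have main : ∀ ε > 0, 0 ≤ v t0 x0 - μ * Real.exp (-lam * (t0 - t1) / r ^ 2) + (k + ε) * (t0 - t1) := by
    intro ε hε
    set φ : ℝ → Eu d → ℝ := fun t x => μ * Real.exp (-lam * (t - t1) / r ^ 2) * (1 - ‖x - x0‖ ^ 2 / r ^ 2) ^ 2 with hφ
    set W : ℝ × Eu d → ℝ := fun z => v z.1 z.2 - φ z.1 z.2 + (k + ε) * (z.1 - t1) with hW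
    have hsub : Icc t1 t0 ×ˢ closedBall x0 r ⊆ parNeg d := by
      rintro ⟨t, x⟩ ⟨h1, h2⟩
      exact ⟨lt_of_le_of_lt h1.2 ht0, mem_univ _⟩
    have hWc : ContinuousOn W (Icc t1 t0 ×ˢ closedBall x0 r) := by
      have h1 := hv.cu.mono hsub
      have h2 : Continuous (fun z : ℝ × Eu d => φ z.1 z.2) := by
        simp only [hφ]; fun_prop
      have h3 : Continuous (fun z : ℝ × Eu d => (k + ε) * (z.1 - t1)) := by fun_prop
      exact (h1.sub h2.continuousOn).add h3.continuousOn
    have hmem0 : (t0, x0) ∈ Icc t1 t0 ×ˢ closedBall x0 r :=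
      ⟨⟨ht, le_rfl⟩, mem_closedBall_self hr.le⟩
    obtain ⟨⟨t, x⟩, hzm, hzmin⟩ := (isCompact_Icc.prod (isCompact_closedBall x0 r)).exists_isMinOn
      ⟨_, hmem0⟩ hWc
    have hge : W (t, x) ≤ W (t0, x0) := hzmin hmem0
    have hW0 : W (t0, x0) = v t0 x0 - μ * Real.exp (-lam * (t0 - t1) / r ^ 2) + (k + ε) * (t0 - t1) := by
      simp [hW, hφ]
    rw [← hW0]
    by_contra hneg
    push Not at hneg
    have hWn : W (t, x) < 0 := lt_of_le_of_lt hge hneg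
    obtain ⟨⟨htt1, htt0⟩, hxr⟩ := hzm
    simp only at htt1 htt0 hxr
    have hxr' : ‖x - x0‖ ≤ r := by rwa [mem_closedBall, dist_eq_norm] at hxr
    have htneg : t < 0 := by linarith
    have hp0 : 0 ≤ 1 - ‖x - x0‖ ^ 2 / r ^ 2 := by
      rw [sub_nonneg, div_le_one (by positivity)]
      exact pow_le_pow_left₀ (norm_nonneg _) hxr' 2
    set p : ℝ := 1 - ‖x - x0‖ ^ 2 / r ^ 2 with hp
    have hp1 : p ≤ 1 := by
      have : 0 ≤ ‖x - x0‖ ^ 2 / r ^ 2 := by positivity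
      linarith
    have ht1t : t1 < t := by
      refine lt_of_le_of_ne htt1 fun h => ?_
      have h1 := hini x hxr'
      simp only [hW, hφ, ← h, ← hp] at hWn
      simp at hWn
      have h2 : p ^ 2 ≤ 1 := pow_le_one₀ hp0 hp1
      have h3 : μ * p ^ 2 ≤ μ * 1 := by gcongr
      linarith
    have hxr2 : ‖x - x0‖ < r := by
      refine lt_of_le_of_ne hxr' fun h => ?_
      have h1 := hv0 t htneg x
      have h2 : p = 0 := by rw [hp, h]; field_simp; simp
      simp only [hW, hφ, ← hp, h2] at hWn
      simp at hWn
      have : 0 ≤ (k + ε) * (t - t1) := mul_nonneg (by linarith) (by linarith)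
      linarith
    set c : ℝ := μ * Real.exp (-lam * (t - t1) / r ^ 2) with hc
    have hc0 : 0 ≤ c := by positivity
    have htime : Ut t x + lam / r ^ 2 * c * p ^ 2 + (k + ε) ≤ 0 := by
      refine left_deriv_nonpos (φ := fun s => W (s, x)) ht1t ?_ ?_
      · have h1 : HasDerivAt (fun s : ℝ => -lam * (s - t1) / r ^ 2) (-lam / r ^ 2) t := by
          have := (((hasDerivAt_id t).sub_const t1).const_mul (-lam)).div_const (r ^ 2)
          simpa using this
        have h2 := (h1.exp.const_mul μ).mul_const (p ^ 2)
        have h3 : HasDerivAt (fun s : ℝ => (k + ε) * (s - t1)) (k + ε) t := by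
          simpa using ((hasDerivAt_id t).sub_const t1).const_mul (k + ε)
        have h4 := ((hv.dt t htneg x).sub h2).add h3
        refine h4.congr_deriv ?_
        rw [hc]; ring
      · intro s hs
        exact hzmin ⟨⟨hs.1, hs.2.trans htt0⟩, hxr⟩
    have hloc : IsLocalMin (fun y => v t y - c * (1 - ‖y - x0‖ ^ 2 / r ^ 2) ^ 2) x := by
      have : x ∈ ball x0 r := by rwa [mem_ball, dist_eq_norm]
      filter_upwards [isOpen_ball.mem_nhds this] with y hy
      have h1 : W (t, x) ≤ W (t, y) := hzmin ⟨⟨htt1, htt0⟩, ball_subset_closedBall hy⟩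
      simp only [hW, hφ, ← hc] at h1
      linarith
    obtain ⟨A, hA, hA1⟩ := hEq t htneg x
    set y := x - x0 with hy
    have hquad : ∀ ξ, (8 * c / r ^ 4) * inner ℝ y ξ ^ 2 + (-4 * c * p / r ^ 2) * ‖ξ‖ ^ 2
        ≤ inner ℝ (H t x ξ) ξ := by
      intro ξ
      have hm := localMin_line hloc ξ
      have hm' : IsLocalMin (fun s : ℝ => v t (x + s • ξ) - c * (p + (-2 * inner ℝ y ξ / r ^ 2) * s
          + (-‖ξ‖ ^ 2 / r ^ 2) * s ^ 2) ^ 2) 0 := by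
        convert hm using 2 with s
        have e1 : x + s • ξ - x0 = y + s • ξ := by rw [hy]; abel
        rw [e1, norm_line_sq, hp]
        ring
      have := (hv.dx t htneg).touch x ξ _ _ _ (sq_d1 _ _ _ _) (sq_d2 _ _ _ _) hm'
      refine le_trans (le_of_eq ?_) this
      field_simp
      ring
    have htr := tr_lower hν hA (H t x) y _ _ (by positivity) hquad
    have hS0 : ∑ i, A i i ≤ D := hA.diag_sum
    have h1 : 4 * c * p / r ^ 2 * ∑ i, A i i ≤ 4 * c * p / r ^ 2 * D := by gcongr
    have h2 : 8 * c / r ^ 4 * ν * ‖y‖ ^ 2 = c / r ^ 2 * (8 * ν * (1 - p)) := by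
      rw [hp]; field_simp; ring
    have h3 : 0 ≤ c / r ^ 2 := by positivity
    have h4 : 0 ≤ lam * p ^ 2 + 8 * ν * (1 - p) - 4 * p * D := by
      have : 0 ≤ 32 * ν * (lam * p ^ 2 + 8 * ν * (1 - p) - 4 * p * D) := by
        have e : 32 * ν * (lam * p ^ 2 + 8 * ν * (1 - p) - 4 * p * D) =
          (32 * ν * lam) * p ^ 2 - 32 * ν * (8 * ν + 4 * D) * p + 256 * ν ^ 2 := by ring
        rw [e, hl]
        nlinarith [sq_nonneg ((8 * ν + 4 * D) * p - 16 * ν)]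
      by_contra hh
      push Not at hh
      nlinarith
    have h5 := mul_nonneg h3 h4
    have h6 : lam / r ^ 2 * c * p ^ 2 = c / r ^ 2 * (lam * p ^ 2) := by ring
    have h7 : 4 * c * p / r ^ 2 * D = c / r ^ 2 * (4 * p * D) := by ring
    have h8 : -4 * c * p / r ^ 2 * ∑ i, A i i = - (4 * c * p / r ^ 2 * ∑ i, A i i) := by ring
    rw [h2, h8] at htr
    rw [h7] at h1
    rw [h6] at htime
    nlinarith
  by_contra hcon
  push Not at hcon
  set e := μ * Real.exp (-lam * (t0 - t1) / r ^ 2) - k * (t0 - t1) - v t0 x0 with he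
  have he0 : 0 < e := by linarith
  have hT : 0 ≤ t0 - t1 := by linarith
  have := main (e / (2 * (t0 - t1 + 1))) (by positivity)
  have h2 : e / (2 * (t0 - t1 + 1)) * (t0 - t1) ≤ e / 2 := by
    rw [div_mul_eq_mul_div, div_le_div_iff₀ (by positivity) (by norm_num)]
    nlinarith
  linarith
/-! ### Second differences in time -/

theorem TC.shift {d : ℕ} {u Ut : ℝ → Eu d → ℝ} {g : ℝ → Eu d → Eu d}
    {H : ℝ → Eu d → Eu d →L[ℝ] Eu d} (hu : TC u Ut g H) (s : ℝ) (hs : 0 ≤ s) :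
    TC (fun t => u (t - s)) (fun t => Ut (t - s)) (fun t => g (t - s)) (fun t => H (t - s)) := by
  have hc : ContinuousOn (fun z : ℝ × Eu d => (z.1 - s, z.2)) (parNeg d) := by fun_prop
  have hm : MapsTo (fun z : ℝ × Eu d => (z.1 - s, z.2)) (parNeg d) (parNeg d) := by
    rintro ⟨t, x⟩ ⟨h, _⟩
    refine ⟨?_, mem_univ _⟩
    simp only [mem_Iio] at h ⊢; linarith
  refine ⟨hu.cu.comp hc hm, hu.ct.comp hc hm, hu.cg.comp hc hm, hu.cH.comp hc hm, ?_, ?_⟩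
  · intro t ht x
    exact (hu.dt (t - s) (by linarith) x).comp_sub_const t s
  · intro t ht
    exact hu.dx (t - s) (by linarith)

theorem C2.lin {d : ℕ} {w : Eu d → ℝ} {g : Eu d → Eu d} {H : Eu d → Eu d →L[ℝ] Eu d}
    {w' : Eu d → ℝ} {g' : Eu d → Eu d} {H' : Eu d → Eu d →L[ℝ] Eu d}
    (hw : C2 w g H) (hw' : C2 w' g' H') : C2 (fun x => w x + w' x)
      (fun x => g x + g' x) (fun x => H x + H' x) where
  d1 x := by
    refine ((hw.d1 x).add (hw'.d1 x)).congr_fderiv ?_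
    simp
  d2 x := (hw.d2 x).add (hw'.d2 x)

theorem TC.add {d : ℕ} {u Ut : ℝ → Eu d → ℝ} {g : ℝ → Eu d → Eu d}
    {H : ℝ → Eu d → Eu d →L[ℝ] Eu d} (hu : TC u Ut g H) {u' Ut' : ℝ → Eu d → ℝ} {g' : ℝ → Eu d → Eu d}
    {H' : ℝ → Eu d → Eu d →L[ℝ] Eu d} (hu' : TC u' Ut' g' H') :
    TC (fun t x => u t x + u' t x) (fun t x => Ut t x + Ut' t x) (fun t x => g t x + g' t x)
      (fun t x => H t x + H' t x) :=
  ⟨hu.cu.add hu'.cu, hu.ct.add hu'.ct, hu.cg.add hu'.cg, hu.cH.add hu'.cH,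
    fun t ht x => (hu.dt t ht x).add (hu'.dt t ht x), fun t ht => (hu.dx t ht).lin (hu'.dx t ht)⟩

theorem TC.smul_add {d : ℕ} {u Ut : ℝ → Eu d → ℝ} {g : ℝ → Eu d → Eu d}
    {H : ℝ → Eu d → Eu d →L[ℝ] Eu d} (hu : TC u Ut g H) (c b : ℝ) :
    TC (fun t x => c * u t x + b) (fun t x => c * Ut t x) (fun t x => c • g t x)
      (fun t x => c • H t x) :=
  ⟨(hu.cu.const_mul c).add continuousOn_const, hu.ct.const_mul c, hu.cg.const_smul c, hu.cH.const_smul c,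
    fun t ht x => ((hu.dt t ht x).const_mul c).add_const b, fun t ht => (hu.dx t ht).smul_add c b⟩

/-- The equation, with the right-hand side eliminated. -/
def QE {d : ℕ} (ν γ K : ℝ) (Ut : ℝ → Eu d → ℝ) (H : ℝ → Eu d → Eu d →L[ℝ] Eu d) : Prop :=
  ∀ x, ∃ A, Ell d ν A ∧ ∀ t < 0, ∀ s < 0,
    |(Ut t x - trA A (H t x)) - (Ut s x - trA A (H s x))| ≤ K * |t - s| ^ γ

def d2 {d : ℕ} (u : ℝ → Eu d → ℝ) (h t : ℝ) (x : Eu d) : ℝ :=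
  u t x - 2 * u (t - h) x + u (t - 2 * h) x

def D2B {d : ℕ} (γ : ℝ) (u : ℝ → Eu d → ℝ) (A : ℝ) : Prop :=
  ∀ h > 0, ∀ t < 0, ∀ x, |d2 u h t x| ≤ A * h ^ (1 + γ)

def Cg (γ : ℝ) : ℝ := 1 + 1 / (1 - (1 / 2) ^ γ)

theorem half_pow {γ : ℝ} (hγ : 0 < γ) : ((1 : ℝ) / 2) ^ γ < 1 :=
  Real.rpow_lt_one (by norm_num) (by norm_num) hγ

theorem Cg_pos {γ : ℝ} (hγ : 0 < γ) : 1 ≤ Cg γ := by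
  have := half_pow hγ
  have : 0 ≤ 1 / (1 - ((1 : ℝ) / 2) ^ γ) := div_nonneg zero_le_one (by linarith)
  rw [Cg]; linarith

theorem dq_close {γ A : ℝ} (hγ : 0 < γ) (hA : 0 ≤ A) (φ : ℝ → ℝ) (φ' t h : ℝ) (hh : 0 < h)
    (hd : HasDerivAt φ φ' t)
    (hb : ∀ h > 0, |φ t - 2 * φ (t - h) + φ (t - 2 * h)| ≤ A * h ^ (1 + γ)) :
    |(φ t - φ (t - h)) / h - φ'| ≤ A * h ^ γ / 2 / (1 - (1 / 2) ^ γ) := by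
  set e : ℕ → ℝ := fun n => (φ t - φ (t - h / 2 ^ n)) / (h / 2 ^ n) with he
  have htend : Tendsto e atTop (nhds φ') := by
    have h1 := (hasDerivAt_iff_tendsto_slope.1 hd)
    have h2 : Tendsto (fun n : ℕ => t - h / 2 ^ n) atTop (nhdsWithin t {t}ᶜ) := by
      apply tendsto_nhdsWithin_of_tendsto_nhds_of_eventually_within
      · have : Tendsto (fun n : ℕ => h * (1 / 2) ^ n) atTop (nhds (h * 0)) :=
          (tendsto_pow_atTop_nhds_zero_of_lt_one (by norm_num) (by norm_num)).const_mul h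
        have h3 := this.const_sub t
        rw [mul_zero, sub_zero] at h3
        refine h3.congr fun n => ?_
        rw [one_div, inv_pow]; rfl
      · refine Eventually.of_forall fun n => ?_
        simp; positivity
    refine (h1.comp h2).congr fun n => ?_
    simp only [Function.comp, slope_def_field, he]
    have : 0 < h / 2 ^ n := by positivity
    rw [← neg_div_neg_eq]
    congr 1 <;> ring
  have hstep : ∀ n, dist (e n) (e (n + 1)) ≤ A * h ^ γ / 2 * ((1 / 2) ^ γ) ^ n := by
    intro n
    set k := h / 2 ^ (n + 1) with hk
    have hk0 : 0 < k := by positivity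
    have hk2 : h / 2 ^ n = 2 * k := by rw [hk, pow_succ]; field_simp
    have h1 := hb k hk0
    have h2 : e n - e (n + 1) = - (φ t - 2 * φ (t - k) + φ (t - 2 * k)) / (2 * k) := by
      simp only [he, hk2, ← hk]; field_simp; ring
    rw [Real.dist_eq, h2, abs_div, abs_neg, abs_of_pos (by positivity : 0 < 2 * k)]
    rw [div_le_iff₀ (by positivity)]
    refine h1.trans ?_
    rw [Real.rpow_add hk0, Real.rpow_one]
    have h3 : k ^ γ ≤ h ^ γ * ((1 / 2) ^ γ) ^ n := by
      rw [← Real.rpow_natCast, ← Real.rpow_mul (by norm_num), mul_comm γ, Real.rpow_mul (by norm_num),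
        Real.rpow_natCast, ← Real.mul_rpow hh.le (by positivity)]
      apply Real.rpow_le_rpow hk0.le _ hγ.le
      have : h * (1 / 2) ^ n = 2 * k := by rw [← hk2, one_div, inv_pow]; rfl
      rw [this]; linarith
    calc A * (k * k ^ γ) ≤ A * (k * (h ^ γ * ((1 / 2) ^ γ) ^ n)) := by gcongr
      _ = _ := by ring
  have := dist_le_of_le_geometric_of_tendsto₀ _ _ (half_pow hγ) hstep htend
  simpa [he, Real.dist_eq] using this

theorem deriv_holder {d : ℕ} {γ A : ℝ} (hγ : 0 < γ) (hA : 0 ≤ A) {u Ut : ℝ → Eu d → ℝ}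
    (hd : ∀ t, t < 0 → ∀ x, HasDerivAt (fun s => u s x) (Ut t x) t) (hb : D2B γ u A)
    (t h : ℝ) (ht : t < 0) (hh : 0 < h) (x : Eu d) :
    |Ut t x - Ut (t - h) x| ≤ Cg γ * A * h ^ γ := by
  have h1 := dq_close hγ hA (fun s => u s x) (Ut t x) t h hh (hd t ht x)
    (fun k hk => hb k hk t ht x)
  have h2 := dq_close hγ hA (fun s => u s x) (Ut (t - h) x) (t - h) h hh (hd (t - h) (by linarith) x)
    (fun k hk => hb k hk (t - h) (by linarith) x)
  have h3 := hb h hh t ht x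
  have h4 : |(u t x - u (t - h) x) / h - (u (t - h) x - u (t - h - h) x) / h| ≤ A * h ^ γ := by
    have e : (u t x - u (t - h) x) / h - (u (t - h) x - u (t - h - h) x) / h = d2 u h t x / h := by
      rw [d2, show t - h - h = t - 2 * h by ring]; ring
    rw [e, abs_div, abs_of_pos hh, div_le_iff₀ hh]
    refine h3.trans (le_of_eq ?_)
    rw [Real.rpow_add hh, Real.rpow_one]; ring
  have e : Cg γ * A * h ^ γ = A * h ^ γ + 2 * (A * h ^ γ / 2 / (1 - (1 / 2) ^ γ)) := by
    rw [Cg]; ring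
  rw [e]
  rw [abs_le] at *
  constructor <;> linarith [h1.1, h1.2, h2.1, h2.2, h4.1, h4.2]

theorem d2_add {d : ℕ} (u : ℝ → Eu d → ℝ) (h t : ℝ) (x : Eu d) :
    d2 u (2 * h) t x = d2 u h t x + 2 * d2 u h (t - h) x + d2 u h (t - 2 * h) x := by
  simp only [d2]
  rw [show t - h - h = t - 2 * h by ring, show t - h - 2 * h = t - 3 * h by ring,
    show t - 2 * h - h = t - 3 * h by ring, show t - 2 * h - 2 * h = t - 4 * h by ring,
    show t - 2 * (2 * h) = t - 4 * h by ring]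
  ring

set_option maxHeartbeats 1000000 in
theorem improve1 (d : ℕ) (ν γ : ℝ) (hν : 0 < ν) (hγ : 0 < γ) (hγ2 : γ < 1 / 2) :
    ∃ κ0 ε : ℝ, 0 < κ0 ∧ 0 < ε ∧ ε < 1 ∧
    ∀ (u Ut : ℝ → Eu d → ℝ) (g : ℝ → Eu d → Eu d) (H : ℝ → Eu d → Eu d →L[ℝ] Eu d) (K A : ℝ),
    TC u Ut g H → QE ν γ K Ut H → 0 ≤ K → 0 < A → K ≤ κ0 * A → D2B γ u A →
    ∀ h > 0, ∀ t < 0, ∀ x, d2 u h t x ≤ (1 - ε) * A * h ^ (1 + γ) := by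
  obtain ⟨F0, r0, hF0, hr0, hosc⟩ := small_osc d ν hν
  obtain ⟨lam, hlam, hbar⟩ := barrier d ν hν
  have hC := Cg_pos hγ
  set C := Cg γ with hCdef
  set κ2 : ℝ := r0 ^ 2 * (F0 / (C + 1)) with hκ2
  have hκpos : 0 < κ2 := by positivity
  set E : ℝ := Real.exp (-(2 * lam / κ2)) with hE
  have hE0 : 0 < E := Real.exp_pos _
  have hE1 : E ≤ 1 := by
    rw [hE, Real.exp_le_one_iff]
    have : 0 < 2 * lam / κ2 := by positivity
    linarith
  refine ⟨E / 64, E / 32, by positivity, by positivity, by linarith, ?_⟩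
  intro u Ut g H K A hu hQ hK hA hKA hb h hh t0 ht0 x0
  set L : ℝ := A * h ^ (1 + γ) with hL
  have hL0 : 0 < L := by positivity
  have hKh : K * h ^ γ ≤ E / 64 * (L / h) := by
    have : L / h = A * h ^ γ := by rw [hL, Real.rpow_add hh, Real.rpow_one]; field_simp
    rw [this]
    have := mul_le_mul_of_nonneg_right hKA (by positivity : 0 ≤ h ^ γ)
    linarith
  have hAh : A * h ^ γ = L / h := by rw [hL, Real.rpow_add hh, Real.rpow_one]; field_simp
  by_contra hcon
  push Not at hcon
  rw [mul_assoc, ← hL] at hcon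
  -- the function v
  have hv := ((hu.add (((hu.shift h hh.le).smul_add (-2) 0).add (hu.shift (2 * h) (by positivity)))).smul_add (-1) L)
  set v : ℝ → Eu d → ℝ := fun t x => L - d2 u h t x with hvdef
  set Vt : ℝ → Eu d → ℝ := fun t x => -(Ut t x - 2 * Ut (t - h) x + Ut (t - 2 * h) x) with hVt
  set HV : ℝ → Eu d → Eu d →L[ℝ] Eu d := fun t x =>
    (-1 : ℝ) • (H t x + ((-2 : ℝ) • H (t - h) x + H (t - 2 * h) x)) with hHV
  have hv' : TC v Vt (fun t x =>
    (-1 : ℝ) • (g t x + ((-2 : ℝ) • g (t - h) x + g (t - 2 * h) x))) HV := by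
    convert hv using 3
    · simp only [hvdef, d2]; ring
    · simp only [hVt]; ring
  clear hv
  have hvb : ∀ t < 0, ∀ x, 0 ≤ v t x ∧ v t x ≤ 2 * L := by
    intro t ht x
    have := abs_le.1 (hb h hh t ht x)
    simp only [hvdef]
    constructor <;> linarith [this.1, this.2]
  have hVtb : ∀ t < 0, ∀ x, |Vt t x| ≤ 2 * C * (L / h) := by
    intro t ht x
    have h1 := deriv_holder hγ hA.le hu.dt hb t h ht hh x
    have h2 := deriv_holder hγ hA.le hu.dt hb (t - h) h (by linarith) hh x
    rw [show t - h - h = t - 2 * h by ring] at h2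
    have e : Cg γ * A * h ^ γ = C * (L / h) := by rw [← hAh]; ring
    rw [e] at h1 h2
    simp only [hVt]
    rw [abs_le] at *
    constructor <;> linarith [h1.1, h1.2, h2.1, h2.2]
  have hres : ∀ x, ∃ B, Ell d ν B ∧ ∀ t < 0, |Vt t x - trA B (HV t x)| ≤ E / 32 * (L / h) := by
    intro x
    obtain ⟨B, hB, hB1⟩ := hQ x
    refine ⟨B, hB, fun t ht => ?_⟩
    have h1 := hB1 t ht (t - h) (by linarith)
    have h2 := hB1 (t - h) (by linarith) (t - 2 * h) (by linarith)
    rw [show t - (t - h) = h by ring, abs_of_pos hh] at h1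
    rw [show t - h - (t - 2 * h) = h by ring, abs_of_pos hh] at h2
    simp only [hVt, hHV]
    rw [trA_smul, trA_add, trA_add, trA_smul]
    rw [abs_le] at *
    constructor <;> linarith [h1.1, h1.2, h2.1, h2.2]
  set l : ℝ := Real.sqrt (F0 / (C + 1) * h) with hl
  have hl0 : 0 < l := Real.sqrt_pos.2 (by positivity)
  have hl2 : l ^ 2 = F0 / (C + 1) * h := Real.sq_sqrt (by positivity)
  have hLh : 0 < L / h := by positivity
  have hsp : ∀ t < 0, ∀ x, ‖x - x0‖ ≤ r0 * l → |v t x - v t x0| ≤ L / 8 := by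
    intro t ht x hx
    refine hosc (v t) _ (HV t) ((2 * C + 2) * (L / h)) L l hL0 hl0 (hv'.dx t ht) ?_ (hvb t ht) ?_ x0 x hx
    · intro y
      obtain ⟨B, hB, hB1⟩ := hres y
      refine ⟨B, hB, ?_⟩
      have h1 := hB1 t ht
      have h2 := hVtb t ht y
      have h3 : E / 32 * (L / h) ≤ 1 * (L / h) := by gcongr; linarith
      rw [abs_le] at *
      constructor <;> linarith [h1.1, h1.2, h2.1, h2.2]
    · rw [hl2]
      apply le_of_eq; field_simp
  have hr2 : (r0 * l) ^ 2 = κ2 * h := by rw [mul_pow, hl2, hκ2]; ring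
  have hlarge : ∀ s, 0 ≤ s → s ≤ 2 * h → v (t0 - s) x0 < L / 4 := by
    intro s hs0 hs
    by_contra hge
    push Not at hge
    have h1 := hbar v Vt _ HV hv' (fun t ht x => (hvb t ht x).1) (E / 32 * (L / h)) (by positivity)
      (fun t ht x => by
        obtain ⟨B, hB, hB1⟩ := hres x
        exact ⟨B, hB, (abs_le.1 (hB1 t ht)).1⟩)
      (t0 - s) t0 x0 (r0 * l) (L / 8) (by linarith) ht0 (by positivity) (by positivity)
      (fun x hx => by
        have := abs_le.1 (hsp (t0 - s) (by linarith) x hx)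
        linarith [this.1])
    rw [show t0 - (t0 - s) = s by ring, hr2] at h1
    have h2 : E ≤ Real.exp (-lam * s / (κ2 * h)) := by
      rw [hE]; apply Real.exp_le_exp.2
      have : lam * s / (κ2 * h) ≤ 2 * lam / κ2 := by
        rw [div_le_div_iff₀ (by positivity) (by positivity)]
        have := mul_le_mul_of_nonneg_left hs (show 0 ≤ lam * κ2 by positivity)
        linarith
      have e : -lam * s / (κ2 * h) = -(lam * s / (κ2 * h)) := by ring
      rw [e]; linarith
    have h3 : L / 8 * E ≤ L / 8 * Real.exp (-lam * s / (κ2 * h)) := by gcongr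
    have h4 : E / 32 * (L / h) * s ≤ E / 32 * (L / h) * (2 * h) := by gcongr
    have h5 : E / 32 * (L / h) * (2 * h) = E * L / 16 := by field_simp; norm_num
    have h6 : v t0 x0 < E / 32 * L := by simp only [hvdef]; linarith
    have : 0 < E * L := by positivity
    linarith
  have a0 := hlarge 0 le_rfl (by positivity)
  have a1 := hlarge h hh.le (by linarith)
  have a2 := hlarge (2 * h) (by positivity) le_rfl
  rw [sub_zero] at a0
  simp only [hvdef] at a0 a1 a2
  have h9 := (abs_le.1 (hb (2 * h) (by positivity) t0 ht0 x0)).2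
  rw [d2_add, Real.mul_rpow (by norm_num) hh.le] at h9
  have h10 : (2 : ℝ) ^ (1 + γ) ≤ 3 := by
    have h1 : (2 : ℝ) ^ (1 + γ) ≤ 2 ^ ((3 : ℝ) / 2) :=
      Real.rpow_le_rpow_of_exponent_le (by norm_num) (by linarith)
    refine h1.trans ?_
    have h2 : ((2 : ℝ) ^ ((3 : ℝ) / 2)) ^ 2 = 8 := by
      rw [← Real.rpow_natCast, ← Real.rpow_mul (by norm_num)]; norm_num
    have h3 : (0 : ℝ) ≤ (2 : ℝ) ^ ((3 : ℝ) / 2) := by positivity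
    nlinarith
  have h11 : A * (2 ^ (1 + γ) * h ^ (1 + γ)) ≤ 3 * L := by
    rw [hL]
    have : 2 ^ (1 + γ) * h ^ (1 + γ) ≤ 3 * h ^ (1 + γ) := by gcongr
    nlinarith
  linarith

theorem improve (d : ℕ) (ν γ : ℝ) (hν : 0 < ν) (hγ : 0 < γ) (hγ2 : γ < 1 / 2) :
    ∃ κ0 : ℝ, 0 < κ0 ∧
    ∀ (u Ut : ℝ → Eu d → ℝ) (g : ℝ → Eu d → Eu d) (H : ℝ → Eu d → Eu d →L[ℝ] Eu d) (K A0 : ℝ),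
    TC u Ut g H → QE ν γ K Ut H → 0 ≤ K → D2B γ u A0 → D2B γ u (K / κ0) := by
  obtain ⟨κ0, ε, hκ0, hε, hε1, himp⟩ := improve1 d ν γ hν hγ hγ2
  refine ⟨κ0, hκ0, ?_⟩
  intro u Ut g H K A0 hu hQ hK hb0
  have hKκ : 0 ≤ K / κ0 := by positivity
  have hstep : ∀ A > 0, K ≤ κ0 * A → D2B γ u A → D2B γ u ((1 - ε) * A) := by
    intro A hA hKA hb h hh t ht x
    have h1 := himp u Ut g H K A hu hQ hK hA hKA hb h hh t ht x
    have hu' := hu.smul_add (-1) 0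
    have h2 := himp _ _ _ _ K A hu' (by
      intro y
      obtain ⟨B, hB, hB1⟩ := hQ y
      refine ⟨B, hB, fun t ht s hs => ?_⟩
      have := hB1 t ht s hs
      rw [trA_smul, trA_smul]
      rw [abs_le] at *
      constructor <;> linarith [this.1, this.2]) hK hA hKA (by
      intro h hh t ht y
      have := hb h hh t ht y
      simp only [d2] at *
      rw [abs_le] at *
      constructor <;> linarith [this.1, this.2]) h hh t ht x
    simp only [d2] at *
    rw [abs_le]
    constructor <;> linarith
  set A1 := |A0| + 1 with hA1
  have hA1p : 0 < A1 := by positivity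
  have hb1 : D2B γ u A1 := fun h hh t ht x => (hb0 h hh t ht x).trans (by
    have : A0 ≤ A1 := by rw [hA1]; linarith [le_abs_self A0]
    gcongr)
  have hn : ∀ n : ℕ, D2B γ u (max ((1 - ε) ^ n * A1) (K / κ0)) := by
    intro n
    induction n with
    | zero =>
      intro h hh t ht x
      refine (hb1 h hh t ht x).trans ?_
      gcongr
      rw [pow_zero, one_mul]; exact le_max_left _ _
    | succ n ih =>
      have hpos : 0 < max ((1 - ε) ^ n * A1) (K / κ0) := by
        apply lt_max_of_lt_left
        have : 0 < 1 - ε := by linarith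
        positivity
      have := hstep _ hpos (by
        rw [mul_comm, ← div_le_iff₀ hκ0]; exact le_max_right _ _) ih
      intro h hh t ht x
      refine (this h hh t ht x).trans ?_
      gcongr
      rw [mul_max_of_nonneg _ _ (by linarith)]
      apply max_le_max
      · rw [pow_succ']; linarith
      · nlinarith
  intro h hh t ht x
  have hlim : Tendsto (fun n : ℕ => max ((1 - ε) ^ n * A1) (K / κ0) * h ^ (1 + γ)) atTop
      (nhds (max (0 * A1) (K / κ0) * h ^ (1 + γ))) := by
    refine Tendsto.mul_const _ (Tendsto.max (Tendsto.mul_const _ ?_) tendsto_const_nhds)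
    exact tendsto_pow_atTop_nhds_zero_of_lt_one (by linarith) (by linarith)
  rw [zero_mul, max_eq_right hKκ] at hlim
  exact ge_of_tendsto' hlim fun n => hn n h hh t ht x
/-! ### Steklov averages -/

theorem par_diff {Y E : Type*} [NormedAddCommGroup Y] [NormedSpace ℝ Y]
    [NormedAddCommGroup E] [NormedSpace ℝ E] [CompleteSpace E]
    (G : Y → ℝ → E) (G' : Y → ℝ → Y →L[ℝ] E) (y0 : Y) (N : Set Y) (hN : N ∈ nhds y0) (hNc : IsCompact N)
    (hG : ∀ y ∈ N, ContinuousOn (G y) (Icc 0 1))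
    (hG' : ContinuousOn (fun z : Y × ℝ => G' z.1 z.2) (N ×ˢ Icc 0 1))
    (hd : ∀ y ∈ N, ∀ s ∈ Icc (0 : ℝ) 1, HasFDerivAt (fun y => G y s) (G' y s) y) :
    HasFDerivAt (fun y => ∫ s in (0 : ℝ)..1, G y s) (∫ s in (0 : ℝ)..1, G' y0 s) y0 := by
  have hI : uIoc (0 : ℝ) 1 ⊆ Icc 0 1 := by
    rw [uIoc_of_le zero_le_one]; exact Ioc_subset_Icc_self
  have hcomp : IsCompact (N ×ˢ Icc (0 : ℝ) 1) := hNc.prod isCompact_Icc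
  obtain ⟨B, hB⟩ := hcomp.exists_bound_of_continuousOn hG'
  have hy0 : y0 ∈ N := mem_of_mem_nhds hN
  have hG'0 : ContinuousOn (G' y0) (Icc 0 1) :=
    hG'.comp (f := fun s : ℝ => (y0, s)) (by fun_prop) (fun s hs => ⟨hy0, hs⟩)
  refine intervalIntegral.hasFDerivAt_integral_of_dominated_of_fderiv_le (bound := fun _ => B) hN ?_ ?_ ?_ ?_ ?_ ?_
  · filter_upwards [hN] with y hy
    exact ((hG y hy).mono hI).aestronglyMeasurable measurableSet_uIoc
  · apply ContinuousOn.intervalIntegrable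
    rw [uIcc_of_le zero_le_one]; exact hG y0 hy0
  · exact (hG'0.mono hI).aestronglyMeasurable measurableSet_uIoc
  · exact Eventually.of_forall fun s hs y hy => hB (y, s) ⟨hy, hI hs⟩
  · exact intervalIntegrable_const
  · exact Eventually.of_forall fun s hs y hy => hd y hy s (hI hs)

/-- Steklov average. -/
def Sk {d : ℕ} {E : Type*} [NormedAddCommGroup E] [NormedSpace ℝ E] (e : ℝ) (F : ℝ → Eu d → E)
    (t : ℝ) (x : Eu d) : E := ∫ s in (0 : ℝ)..1, F (t - e * s) x

theorem Sk_cont {d : ℕ} {E : Type*} [NormedAddCommGroup E] [NormedSpace ℝ E] (e : ℝ)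
    (he : 0 < e) (F : ℝ → Eu d → E) (hF : ContinuousOn (fun z : ℝ × Eu d => F z.1 z.2) (parNeg d)) :
    ContinuousOn (fun z : ℝ × Eu d => Sk e F z.1 z.2) (parNeg d) := by
  rintro ⟨t0, x0⟩ ⟨ht0, _⟩
  simp only [mem_Iio] at ht0
  apply ContinuousAt.continuousWithinAt
  set c := t0 / 2 with hc
  have hF' : Continuous (fun z : ℝ × Eu d => F (min z.1 c) z.2) := by
    rw [← continuousOn_univ]
    refine hF.comp (f := fun z : ℝ × Eu d => (min z.1 c, z.2)) (by fun_prop) ?_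
    rintro z -
    refine ⟨?_, mem_univ _⟩
    simp only [mem_Iio]
    exact lt_of_le_of_lt (min_le_right _ _) (by linarith)
  have h1 : Continuous (fun z : ℝ × Eu d => ∫ s in (0 : ℝ)..1, F (min (z.1 - e * s) c) z.2) := by
    apply intervalIntegral.continuous_parametric_intervalIntegral_of_continuous'
    exact hF'.comp (f := fun q : (ℝ × Eu d) × ℝ => (q.1.1 - e * q.2, q.1.2)) (by fun_prop)
  refine h1.continuousAt.congr ?_
  have : ∀ᶠ z : ℝ × Eu d in nhds (t0, x0), z.1 < c := by
    apply continuous_fst.continuousAt.eventually_lt continuousAt_const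
    simp only; linarith
  filter_upwards [this] with z hz
  apply intervalIntegral.integral_congr
  intro s hs
  rw [uIcc_of_le zero_le_one] at hs
  have : z.1 - e * s ≤ c := by nlinarith [hs.1]
  simp only [min_eq_left this]

theorem slice_cont {d : ℕ} {E : Type*} [NormedAddCommGroup E] (e : ℝ)
    (he : 0 < e) (F : ℝ → Eu d → E) (hF : ContinuousOn (fun z : ℝ × Eu d => F z.1 z.2) (parNeg d))
    (t : ℝ) (ht : t < 0) (x : Eu d) : ContinuousOn (fun s => F (t - e * s) x) (Icc 0 1) := by
  refine hF.comp (f := fun s : ℝ => (t - e * s, x)) (by fun_prop) ?_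
  intro s hs
  refine ⟨?_, mem_univ _⟩
  simp only [mem_Iio]; nlinarith [hs.1]

theorem slice_int {d : ℕ} {E : Type*} [NormedAddCommGroup E] (e : ℝ)
    (he : 0 < e) (F : ℝ → Eu d → E) (hF : ContinuousOn (fun z : ℝ × Eu d => F z.1 z.2) (parNeg d))
    (t : ℝ) (ht : t < 0) (x : Eu d) : IntervalIntegrable (fun s => F (t - e * s) x) volume 0 1 := by
  apply ContinuousOn.intervalIntegrable
  rw [uIcc_of_le zero_le_one]; exact slice_cont e he F hF t ht x

theorem Sk_dx {d : ℕ} {E : Type*} [NormedAddCommGroup E] [NormedSpace ℝ E] [CompleteSpace E] (e : ℝ)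
    (he : 0 < e) (F : ℝ → Eu d → E) (F' : ℝ → Eu d → Eu d →L[ℝ] E)
    (hF : ContinuousOn (fun z : ℝ × Eu d => F z.1 z.2) (parNeg d))
    (hF' : ContinuousOn (fun z : ℝ × Eu d => F' z.1 z.2) (parNeg d))
    (hd : ∀ t < 0, ∀ x, HasFDerivAt (F t) (F' t x) x) (t : ℝ) (ht : t < 0) (x : Eu d) :
    HasFDerivAt (Sk e F t) (Sk e F' t x) x := by
  refine par_diff (fun y s => F (t - e * s) y) (fun y s => F' (t - e * s) y) x (closedBall x 1)
    (closedBall_mem_nhds x one_pos) (isCompact_closedBall x 1) ?_ ?_ ?_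
  · intro y _
    exact slice_cont e he F hF t ht y
  · refine hF'.comp (f := fun z : Eu d × ℝ => (t - e * z.2, z.1)) (by fun_prop) ?_
    rintro ⟨y, s⟩ ⟨_, hs⟩
    refine ⟨?_, mem_univ _⟩
    simp only [mem_Iio]; nlinarith [hs.1]
  · intro y _ s hs
    exact hd _ (by nlinarith [hs.1]) y

theorem Sk_dt {d : ℕ} (e : ℝ) (he : 0 < e) (F F' : ℝ → Eu d → ℝ)
    (hF : ContinuousOn (fun z : ℝ × Eu d => F z.1 z.2) (parNeg d))
    (hF' : ContinuousOn (fun z : ℝ × Eu d => F' z.1 z.2) (parNeg d))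
    (hd : ∀ t < 0, ∀ x, HasDerivAt (fun s => F s x) (F' t x) t) (t : ℝ) (ht : t < 0) (x : Eu d) :
    HasDerivAt (fun s => Sk e F s x) (Sk e F' t x) t := by
  have hNneg : ∀ y ∈ Icc (t - 1) (t / 2), y < 0 := fun y hy => by linarith [hy.2]
  have hc : ContinuousOn (fun z : ℝ × ℝ => F' (z.1 - e * z.2) x) (Icc (t - 1) (t / 2) ×ˢ Icc 0 1) := by
    refine hF'.comp (f := fun z : ℝ × ℝ => (z.1 - e * z.2, x)) (by fun_prop) ?_
    rintro ⟨y, s⟩ ⟨hy, hs⟩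
    refine ⟨?_, mem_univ _⟩
    have := hNneg y hy
    simp only [mem_Iio]; nlinarith [hs.1]
  have h := par_diff (fun y s => F (y - e * s) x)
    (fun y s => ContinuousLinearMap.toSpanSingleton ℝ (F' (y - e * s) x)) t (Icc (t - 1) (t / 2))
    (Icc_mem_nhds (by linarith) (by linarith)) isCompact_Icc ?_ ?_ ?_
  · have h2 := h.hasDerivAt
    refine HasDerivAt.congr_deriv h2 ?_
    rw [ContinuousLinearMap.intervalIntegral_apply]
    · simp [Sk]
    · apply ContinuousOn.intervalIntegrable
      rw [uIcc_of_le zero_le_one]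
      have := slice_cont e he F' hF' t ht x
      exact (ContinuousLinearMap.toSpanSingletonCLE (𝕜 := ℝ) (E := ℝ)).continuous.comp_continuousOn this
  · intro y hy
    exact slice_cont e he F hF y (hNneg y hy) x
  · exact (ContinuousLinearMap.toSpanSingletonCLE (𝕜 := ℝ) (E := ℝ)).continuous.comp_continuousOn hc
  · intro y hy s hs
    have := hNneg y hy
    have h3 := (hd (y - e * s) (by nlinarith [hs.1]) x).comp_sub_const y (e * s)
    exact h3.hasFDerivAt

theorem TC.sk {d : ℕ} {u Ut : ℝ → Eu d → ℝ} {g : ℝ → Eu d → Eu d}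
    {H : ℝ → Eu d → Eu d →L[ℝ] Eu d} (hu : TC u Ut g H) (e : ℝ) (he : 0 < e) :
    TC (Sk e u) (Sk e Ut) (Sk e g) (Sk e H) where
  cu := Sk_cont e he u hu.cu
  ct := Sk_cont e he Ut hu.ct
  cg := Sk_cont e he g hu.cg
  cH := Sk_cont e he H hu.cH
  dt := Sk_dt e he u Ut hu.cu hu.ct hu.dt
  dx t ht := by
    constructor
    · intro x
      have h1 := Sk_dx e he u (fun t x => (innerSL ℝ : Eu d →L⋆[ℝ] _).toContinuousLinearMap (g t x)) hu.cu
        ((innerSL ℝ : Eu d →L⋆[ℝ] _).toContinuousLinearMap.continuous.comp_continuousOn hu.cg)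
        (fun t ht x => (hu.dx t ht).d1 x) t ht x
      refine h1.congr_fderiv ?_
      simp only [Sk]
      exact ContinuousLinearMap.intervalIntegral_comp_comm (innerSL ℝ : Eu d →L⋆[ℝ] _).toContinuousLinearMap
        (slice_int e he g hu.cg t ht x)
    · intro x
      exact Sk_dx e he g H hu.cg hu.cH (fun t ht x => (hu.dx t ht).d2 x) t ht x

def trL {d : ℕ} (A : Fin d → Fin d → ℝ) : (Eu d →L[ℝ] Eu d) →L[ℝ] ℝ :=
  LinearMap.toContinuousLinearMap
    { toFun := trA A
      map_add' := trA_add A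
      map_smul' := fun c B => trA_smul A c B }

theorem trL_apply {d : ℕ} (A : Fin d → Fin d → ℝ) (B : Eu d →L[ℝ] Eu d) : trL A B = trA A B := rfl

theorem QE.sk {d : ℕ} {ν γ K : ℝ} {u Ut : ℝ → Eu d → ℝ} {g : ℝ → Eu d → Eu d}
    {H : ℝ → Eu d → Eu d →L[ℝ] Eu d} (hu : TC u Ut g H) (hQ : QE ν γ K Ut H) (e : ℝ) (he : 0 < e) :
    QE ν γ K (Sk e Ut) (Sk e H) := by
  intro x
  obtain ⟨A, hA, h⟩ := hQ x
  refine ⟨A, hA, fun t ht s hs => ?_⟩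
  have key : ∀ t < 0, Sk e Ut t x - trA A (Sk e H t x) =
      ∫ r in (0 : ℝ)..1, (Ut (t - e * r) x - trA A (H (t - e * r) x)) := by
    intro t ht
    rw [← trL_apply, Sk, Sk, ← ContinuousLinearMap.intervalIntegral_comp_comm (trL A) (slice_int e he H hu.cH t ht x),
      ← intervalIntegral.integral_sub (slice_int e he Ut hu.ct t ht x)]
    · rfl
    · apply ContinuousOn.intervalIntegrable
      rw [uIcc_of_le zero_le_one]
      exact (trL A).continuous.comp_continuousOn (slice_cont e he H hu.cH t ht x)
  have hintg : ∀ t < 0, IntervalIntegrable (fun r => Ut (t - e * r) x - trA A (H (t - e * r) x)) volume 0 1 := by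
    intro t ht
    apply ContinuousOn.intervalIntegrable
    rw [uIcc_of_le zero_le_one]
    exact (slice_cont e he Ut hu.ct t ht x).sub
      ((trL A).continuous.comp_continuousOn (slice_cont e he H hu.cH t ht x))
  rw [key t ht, key s hs, ← intervalIntegral.integral_sub (hintg t ht) (hintg s hs), ← Real.norm_eq_abs]
  have := intervalIntegral.norm_integral_le_of_norm_le_const (a := 0) (b := 1) (C := K * |t - s| ^ γ)
    (f := fun r => (Ut (t - e * r) x - trA A (H (t - e * r) x)) - (Ut (s - e * r) x - trA A (H (s - e * r) x))) ?_
  · simpa using this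
  · intro r hr
    rw [uIoc_of_le zero_le_one] at hr
    have h1 := h (t - e * r) (by nlinarith [hr.1]) (s - e * r) (by nlinarith [hr.1])
    rw [show t - e * r - (s - e * r) = t - s by ring] at h1
    exact h1

theorem Sk_close {d : ℕ} (e : ℝ) (he : 0 < e) (F : ℝ → Eu d → ℝ)
    (hF : ContinuousOn (fun z : ℝ × Eu d => F z.1 z.2) (parNeg d)) (t : ℝ) (ht : t < 0) (x : Eu d) (c η : ℝ)
    (h : ∀ s ∈ Icc (0 : ℝ) 1, |F (t - e * s) x - c| ≤ η) : |Sk e F t x - c| ≤ η := by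
  have e1 : Sk e F t x - c = ∫ s in (0 : ℝ)..1, (F (t - e * s) x - c) := by
    rw [intervalIntegral.integral_sub (slice_int e he F hF t ht x) intervalIntegrable_const]
    simp [Sk]
  rw [e1, ← Real.norm_eq_abs]
  have := intervalIntegral.norm_integral_le_of_norm_le_const (a := 0) (b := 1) (C := η)
    (f := fun s => F (t - e * s) x - c) (fun s hs => by
      rw [uIoc_of_le zero_le_one] at hs
      exact h s ⟨hs.1.le, hs.2⟩)
  simpa using this

theorem Sk_ftc {d : ℕ} {u Ut : ℝ → Eu d → ℝ} {g : ℝ → Eu d → Eu d}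
    {H : ℝ → Eu d → Eu d →L[ℝ] Eu d} (hu : TC u Ut g H) (e : ℝ) (he : 0 < e) (t : ℝ) (ht : t < 0) (x : Eu d) :
    Sk e Ut t x = (u t x - u (t - e) x) / e := by
  have h := intervalIntegral.integral_eq_sub_of_hasDerivAt (a := 0) (b := 1)
    (f := fun s => u (t - e * s) x) (f' := fun s => -e * Ut (t - e * s) x) ?_ ?_
  · rw [intervalIntegral.integral_const_mul] at h
    simp only [Sk]
    rw [eq_div_iff he.ne']
    simp at h
    linarith
  · intro s hs
    rw [uIcc_of_le zero_le_one] at hs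
    have h1 := hu.dt (t - e * s) (by nlinarith [hs.1]) x
    have h2 : HasDerivAt (fun s : ℝ => t - e * s) (-e) s := by
      simpa using ((hasDerivAt_id s).const_mul e).const_sub t
    have := h1.comp s h2
    refine this.congr_deriv ?_
    ring
  · exact (slice_int e he Ut hu.ct t ht x).const_mul (-e)

theorem lip_of_deriv {φ φ' : ℝ → ℝ} {B : ℝ} (hd : ∀ t < 0, HasDerivAt φ (φ' t) t)
    (hb : ∀ t < 0, |φ' t| ≤ B) (t h : ℝ) (ht : t < 0) (hh : 0 ≤ h) : |φ t - φ (t - h)| ≤ B * h := by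
  have := (convex_Iio (0 : ℝ)).norm_image_sub_le_of_norm_hasDerivWithin_le (f := φ) (f' := φ') (C := B)
    (fun s hs => (hd s hs).hasDerivWithinAt) (fun s hs => hb s hs) (x := t - h) (y := t)
    (mem_Iio.2 (by linarith)) (mem_Iio.2 ht)
  simpa [abs_of_nonneg hh] using this

theorem sk2_bound {d : ℕ} {γ : ℝ} (hγ : 0 < γ) (hγ2 : γ < 1 / 2) {u Ut : ℝ → Eu d → ℝ} {g : ℝ → Eu d → Eu d}
    {H : ℝ → Eu d → Eu d →L[ℝ] Eu d} (hu : TC u Ut g H) (e : ℝ) (he : 0 < e) (M : ℝ)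
    (hM : ∀ t < 0, ∀ x, |u t x| ≤ M) : ∃ A0, D2B γ (Sk e (Sk e u)) A0 := by
  have h1 := hu.sk e he
  have h2 := h1.sk e he
  have hM0 : 0 ≤ M := (abs_nonneg _).trans (hM (-1) (by norm_num) 0)
  have hbS : ∀ t < 0, ∀ x, |Sk e u t x| ≤ M := by
    intro t ht x
    have := Sk_close e he u hu.cu t ht x 0 M (fun s hs => by
      rw [sub_zero]; exact hM _ (by nlinarith [hs.1]) x)
    rwa [sub_zero] at this
  have hbSS : ∀ t < 0, ∀ x, |Sk e (Sk e u) t x| ≤ M := by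
    intro t ht x
    have := Sk_close e he _ h1.cu t ht x 0 M (fun s hs => by
      rw [sub_zero]; exact hbS _ (by nlinarith [hs.1]) x)
    rwa [sub_zero] at this
  have hbt : ∀ t < 0, ∀ x, |Sk e Ut t x| ≤ 2 * M / e := by
    intro t ht x
    rw [Sk_ftc hu e he t ht x, abs_div, abs_of_pos he]
    gcongr
    have a1 := abs_le.1 (hM t ht x)
    have a2 := abs_le.1 (hM (t - e) (by linarith) x)
    rw [abs_le]; constructor <;> linarith [a1.1, a1.2, a2.1, a2.2]
  set B := 2 * M / e with hB
  have hB0 : 0 ≤ B := by positivity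
  have hlip : ∀ x, ∀ t h : ℝ, t < 0 → 0 ≤ h → |Sk e u t x - Sk e u (t - h) x| ≤ B * h := fun x t h ht hh =>
    lip_of_deriv (fun s hs => h1.dt s hs x) (fun s hs => hbt s hs x) t h ht hh
  have hlip2 : ∀ x, ∀ t h : ℝ, t < 0 → 0 ≤ h →
      |Sk e (Sk e Ut) t x - Sk e (Sk e Ut) (t - h) x| ≤ 2 * B / e * h := by
    intro x t h ht hh
    rw [Sk_ftc h1 e he t ht x, Sk_ftc h1 e he (t - h) (by linarith) x]
    have a1 := hlip x t h ht hh
    have a2 := hlip x (t - e) h (by linarith) hh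
    rw [show t - e - h = t - h - e by ring] at a2
    rw [← sub_div, abs_div, abs_of_pos he, div_mul_eq_mul_div]
    gcongr
    rw [abs_le] at *
    constructor <;> linarith [a1.1, a1.2, a2.1, a2.2]
  refine ⟨4 * M + 2 * B / e, fun h hh t ht x => ?_⟩
  have hBe : 0 ≤ 2 * B / e := by positivity
  rcases le_total 1 h with h1' | h1'
  · have a0 := abs_le.1 (hbSS t ht x)
    have a1 := abs_le.1 (hbSS (t - h) (by linarith) x)
    have a2 := abs_le.1 (hbSS (t - 2 * h) (by linarith) x)
    have hp : 1 ≤ h ^ (1 + γ) := Real.one_le_rpow h1' (by linarith)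
    have h4 : |d2 (Sk e (Sk e u)) h t x| ≤ 4 * M := by
      rw [d2, abs_le]; constructor <;> linarith [a0.1, a0.2, a1.1, a1.2, a2.1, a2.2]
    nlinarith
  · have h3 := lip_of_deriv (φ := fun s => Sk e (Sk e u) s x - Sk e (Sk e u) (s - h) x)
      (φ' := fun s => Sk e (Sk e Ut) s x - Sk e (Sk e Ut) (s - h) x) (B := 2 * B / e * h)
      (fun s hs => (h2.dt s hs x).sub ((h2.dt (s - h) (by linarith) x).comp_sub_const s h))
      (fun s hs => hlip2 x s h hs hh.le) t h ht hh.le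
    have h4 : |d2 (Sk e (Sk e u)) h t x| ≤ 2 * B / e * h * h := by
      refine le_trans (le_of_eq ?_) h3
      simp only [d2]
      rw [show t - h - h = t - 2 * h by ring]; congr 1; ring
    have h5 : h * h ≤ h ^ (1 + γ) := by
      have : h * h = h ^ (2 : ℝ) := by rw [Real.rpow_two]; ring
      rw [this]
      exact Real.rpow_le_rpow_of_exponent_ge hh h1' (by linarith)
    have h6 : 0 ≤ h ^ (1 + γ) := by positivity
    nlinarith

theorem sk2_lim {d : ℕ} {u Ut : ℝ → Eu d → ℝ} {g : ℝ → Eu d → Eu d}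
    {H : ℝ → Eu d → Eu d →L[ℝ] Eu d} (hu : TC u Ut g H) (t : ℝ) (ht : t < 0) (x : Eu d) (η : ℝ) (hη : 0 < η) :
    ∃ e0 > 0, ∀ e, 0 < e → e ≤ e0 → |Sk e (Sk e u) t x - u t x| ≤ η := by
  obtain ⟨δ, hδ, h⟩ := Metric.continuousAt_iff.1 (hu.dt t ht x).continuousAt η hη
  refine ⟨δ / 3, by positivity, fun e he hle => ?_⟩
  apply Sk_close e he _ (hu.sk e he).cu t ht
  intro s hs
  apply Sk_close e he _ hu.cu (t - e * s) (by nlinarith [hs.1])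
  intro r hr
  have h1 := h (x := t - e * s - e * r) (by
    rw [Real.dist_eq, show t - e * s - e * r - t = -(e * s + e * r) by ring, abs_neg, abs_of_nonneg
      (add_nonneg (mul_nonneg he.le hs.1) (mul_nonneg he.le hr.1))]
    nlinarith [hs.2, hr.2])
  rw [Real.dist_eq] at h1
  exact h1.le

theorem main_est (d : ℕ) (ν γ : ℝ) (hν : 0 < ν) (hγ : 0 < γ) (hγ2 : γ < 1 / 2) :
    ∃ N : ℝ, 0 < N ∧
    ∀ (u Ut : ℝ → Eu d → ℝ) (g : ℝ → Eu d → Eu d) (H : ℝ → Eu d → Eu d →L[ℝ] Eu d) (K M : ℝ),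
    TC u Ut g H → QE ν γ K Ut H → 0 ≤ K → (∀ t < 0, ∀ x, |u t x| ≤ M) →
    ∀ t < 0, ∀ h > 0, ∀ x, |Ut t x - Ut (t - h) x| ≤ N * K * h ^ γ := by
  obtain ⟨κ0, hκ0, himp⟩ := improve d ν γ hν hγ hγ2
  have hC := Cg_pos hγ
  refine ⟨Cg γ / κ0, by positivity, ?_⟩
  intro u Ut g H K M hu hQ hK hM
  have hb : D2B γ u (K / κ0) := by
    intro h hh t ht x
    refine le_of_forall_pos_le_add fun η hη => ?_
    obtain ⟨e0, he0, h0⟩ := sk2_lim hu t ht x (η / 4) (by positivity)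
    obtain ⟨e1, he1, h1⟩ := sk2_lim hu (t - h) (by linarith) x (η / 4) (by positivity)
    obtain ⟨e2, he2, h2⟩ := sk2_lim hu (t - 2 * h) (by linarith) x (η / 4) (by positivity)
    set e := min e0 (min e1 e2) with he
    have hep : 0 < e := by positivity
    obtain ⟨A0, hA0⟩ := sk2_bound hγ hγ2 hu e hep M hM
    have hS := himp _ _ _ _ K A0 ((hu.sk e hep).sk e hep) (QE.sk (hu.sk e hep) (QE.sk hu hQ e hep) e hep) hK hA0
      h hh t ht x
    have b0 := h0 e hep (min_le_left _ _)
    have b1 := h1 e hep ((min_le_right _ _).trans (min_le_left _ _))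
    have b2 := h2 e hep ((min_le_right _ _).trans (min_le_right _ _))
    simp only [d2] at *
    rw [abs_le] at *
    constructor <;> linarith [hS.1, hS.2, b0.1, b0.2, b1.1, b1.2, b2.1, b2.2]
  intro t ht h hh x
  have := deriv_holder hγ (by positivity) hu.dt hb t h ht hh x
  refine this.trans (le_of_eq ?_)
  ring
/-! ### Reduction from the coordinate formulation -/

def gU {d : ℕ} (u : ℝ → Eu d → ℝ) (t : ℝ) (x : Eu d) : Eu d :=
  WithLp.toLp 2 (fun i => sd i (u t) x)

def hU {d : ℕ} (u : ℝ → Eu d → ℝ) (t : ℝ) (x : Eu d) : Eu d →L[ℝ] Eu d :=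
  fderiv ℝ (gU u t) x

theorem eu_ext_lin {d : ℕ} {F : Type*} [NormedAddCommGroup F] [NormedSpace ℝ F] (L M : Eu d →L[ℝ] F)
    (h : ∀ i, L (EuclideanSpace.single i 1) = M (EuclideanSpace.single i 1)) : L = M := by
  ext v
  rw [eu_sum v]
  simp only [map_sum, map_smul, h]

theorem gU_diff {d : ℕ} (u : ℝ → Eu d → ℝ) (t : ℝ) (x : Eu d) (h : ContDiffAt ℝ 2 (u t) x) (i : Fin d) :
    DifferentiableAt ℝ (fun y => sd i (u t) y) x := by
  have h1 : ContDiffAt ℝ 1 (fderiv ℝ (u t)) x := h.fderiv_right (by norm_num)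
  have h2 := h1.differentiableAt (by norm_num)
  exact h2.clm_apply (differentiableAt_const _)

theorem gU_diff2 {d : ℕ} (u : ℝ → Eu d → ℝ) (t : ℝ) (x : Eu d) (h : ContDiffAt ℝ 2 (u t) x) :
    DifferentiableAt ℝ (gU u t) x := by
  rw [differentiableAt_euclidean]
  intro i
  exact gU_diff u t x h i

theorem hU_apply {d : ℕ} (u : ℝ → Eu d → ℝ) (t : ℝ) (x : Eu d) (h : ContDiffAt ℝ 2 (u t) x) (i j : Fin d) :
    (hU u t x (EuclideanSpace.single i 1)) j = sd2 i j (u t) x := by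
  have h1 := (gU_diff2 u t x h).hasFDerivAt
  have h2 := ((EuclideanSpace.proj (𝕜 := ℝ) j).hasFDerivAt.comp x h1).fderiv
  have h3 : sd2 i j (u t) x = fderiv ℝ (fun y => (gU u t y) j) x (EuclideanSpace.single i 1) := rfl
  rw [h3]
  exact (congrArg (fun L : Eu d →L[ℝ] ℝ => L (EuclideanSpace.single i 1)) h2).symm

theorem trA_hU {d : ℕ} (u : ℝ → Eu d → ℝ) (t : ℝ) (x : Eu d) (h : ContDiffAt ℝ 2 (u t) x)
    (A : Fin d → Fin d → ℝ) : trA A (hU u t x) = ∑ i, ∑ j, A i j * sd2 i j (u t) x := by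
  simp only [trA, hU_apply u t x h]

theorem tc_of_classical {d : ℕ} (u : ℝ → Eu d → ℝ) (h : ParClassical (parNeg d) u) :
    TC u (td u) (gU u) (hU u) := by
  obtain ⟨hdt, hdx, hcu, hct, hcg, hcH⟩ := h
  have hm : ∀ t < 0, ∀ x : Eu d, (t, x) ∈ parNeg d := fun t ht x => ⟨ht, mem_univ _⟩
  refine ⟨hcu, hct, ?_, ?_, ?_, ?_⟩
  · refine (PiLp.continuous_toLp 2 (fun _ : Fin d => ℝ)).comp_continuousOn ?_
    exact continuousOn_pi.2 hcg
  · rw [continuousOn_clm_apply]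
    intro v
    have : ∀ z ∈ parNeg d, hU u z.1 z.2 v =
        WithLp.toLp 2 (fun j => ∑ i, v i * sd2 i j (u z.1) z.2) := by
      intro z hz
      conv_lhs => rw [eu_sum v]
      ext j
      simp [hU_apply u z.1 z.2 (hdx z hz)]
    refine ContinuousOn.congr ?_ this
    refine (PiLp.continuous_toLp 2 (fun _ : Fin d => ℝ)).comp_continuousOn ?_
    refine continuousOn_pi.2 fun j => ?_
    exact continuousOn_finsetSum _ fun i _ => continuousOn_const.mul (hcH i j)
  · intro t ht x
    exact (hdt (t, x) (hm t ht x)).hasDerivAt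
  · intro t ht
    constructor
    · intro x
      have h1 := ((hdx (t, x) (hm t ht x)).differentiableAt (by norm_num)).hasFDerivAt
      have e : innerSL ℝ (gU u t x) = fderiv ℝ (u t) x := ?_
      · rw [e]; exact h1
      refine eu_ext_lin _ _ fun i => ?_
      rw [innerSL_apply_apply, eu_inner]
      simp [gU, sd, Pi.single_apply]
    · intro x
      exact (gU_diff2 u t x (hdx (t, x) (hm t ht x))).hasFDerivAt

theorem sum_two_quad {d : ℕ} (A : Fin d → Fin d → ℝ) (i j : Fin d) (c : ℝ) :
    ∑ k, ∑ l, A k l * ((Pi.single i 1 : Fin d → ℝ) k + c * (Pi.single j 1 : Fin d → ℝ) k) *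
      ((Pi.single i 1 : Fin d → ℝ) l + c * (Pi.single j 1 : Fin d → ℝ) l) =
      A i i + c * A i j + c * A j i + c ^ 2 * A j j := by
  have h : ∀ k l, A k l * ((Pi.single i 1 : Fin d → ℝ) k + c * (Pi.single j 1 : Fin d → ℝ) k) *
      ((Pi.single i 1 : Fin d → ℝ) l + c * (Pi.single j 1 : Fin d → ℝ) l) =
      A k l * (Pi.single i 1 : Fin d → ℝ) k * (Pi.single i 1 : Fin d → ℝ) l
      + c * (A k l * (Pi.single i 1 : Fin d → ℝ) k * (Pi.single j 1 : Fin d → ℝ) l)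
      + c * (A k l * (Pi.single j 1 : Fin d → ℝ) k * (Pi.single i 1 : Fin d → ℝ) l)
      + c ^ 2 * (A k l * (Pi.single j 1 : Fin d → ℝ) k * (Pi.single j 1 : Fin d → ℝ) l) := by
    intro k l; ring
  simp only [h, Finset.sum_add_distrib, ← Finset.mul_sum]
  simp [Pi.single_apply]

theorem ell_bdd {d : ℕ} {ν : ℝ} (hν : 0 < ν) {A : Fin d → Fin d → ℝ} (h : Ell d ν A) (i j : Fin d) :
    |A i j| ≤ 4 * ν⁻¹ := by
  have hdg : ∀ i, 0 ≤ A i i ∧ A i i ≤ ν⁻¹ := by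
    intro i
    have := h.2 (fun k => (Pi.single i 1 : Fin d → ℝ) k + 0 * (Pi.single i 1 : Fin d → ℝ) k)
    rw [sum_two_quad] at this
    have e : ∑ k, ((Pi.single i 1 : Fin d → ℝ) k + 0 * (Pi.single i 1 : Fin d → ℝ) k) ^ 2 = 1 := by
      simp [Pi.single_apply]
    rw [e] at this
    constructor <;> linarith [this.1, this.2]
  have hν' : 0 < ν⁻¹ := inv_pos.2 hν
  have hp : ∀ c : ℝ, 0 ≤ A i i + c * A i j + c * A j i + c ^ 2 * A j j := by
    intro c
    have := (h.2 (fun k => (Pi.single i 1 : Fin d → ℝ) k + c * (Pi.single j 1 : Fin d → ℝ) k)).1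
    rw [sum_two_quad] at this
    exact le_trans (by positivity) this
  have h1 := hp 1
  have h2 := hp (-1)
  have hs := h.1 i j
  have a1 := hdg i
  have a2 := hdg j
  rw [abs_le]
  constructor <;> linarith

theorem ell_compact {d : ℕ} {ν : ℝ} (hν : 0 < ν) : IsCompact {A : Fin d → Fin d → ℝ | Ell d ν A} := by
  refine IsCompact.of_isClosed_subset
    (isCompact_univ_pi fun _ : Fin d => isCompact_univ_pi fun _ : Fin d => isCompact_Icc (a := -(4 * ν⁻¹)) (b := 4 * ν⁻¹)) ?_ ?_
  · have : {A : Fin d → Fin d → ℝ | Ell d ν A} =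
        (⋂ i, ⋂ j, {A : Fin d → Fin d → ℝ | A i j = A j i}) ∩
        ⋂ ξ : Fin d → ℝ, ({A : Fin d → Fin d → ℝ | ν * ∑ i, ξ i ^ 2 ≤ ∑ i, ∑ j, A i j * ξ i * ξ j} ∩
          {A : Fin d → Fin d → ℝ | ∑ i, ∑ j, A i j * ξ i * ξ j ≤ ν⁻¹ * ∑ i, ξ i ^ 2}) := by
      ext A
      simp [Ell]
    rw [this]
    refine IsClosed.inter ?_ ?_
    · refine isClosed_iInter fun i => isClosed_iInter fun j => isClosed_eq ?_ ?_ <;> fun_prop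
    · refine isClosed_iInter fun ξ => IsClosed.inter (isClosed_le ?_ ?_) (isClosed_le ?_ ?_) <;> fun_prop
  · intro A hA i _ j _
    exact abs_le.1 (ell_bdd hν hA i j)

theorem holder_cont {φ : ℝ → ℝ} {K γ : ℝ} (hγ : 0 < γ)
    (h : ∀ t < 0, ∀ s < 0, |φ t - φ s| ≤ K * |t - s| ^ γ) : ContinuousOn φ (Iio 0) := by
  intro s hs
  rw [ContinuousWithinAt, tendsto_iff_dist_tendsto_zero]
  have h0 : Tendsto (fun t : ℝ => K * |t - s| ^ γ) (nhdsWithin s (Iio 0)) (nhds 0) := by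
    have : Continuous (fun t : ℝ => K * |t - s| ^ γ) :=
      continuous_const.mul ((continuous_abs.comp (continuous_id.sub continuous_const)).rpow_const
        (fun _ => Or.inr hγ.le))
    have h2 := this.tendsto s
    simp only [sub_self, abs_zero, Real.zero_rpow hγ.ne', mul_zero] at h2
    exact h2.mono_left nhdsWithin_le_nhds
  refine squeeze_zero' (Eventually.of_forall fun _ => dist_nonneg) ?_ h0
  filter_upwards [self_mem_nhdsWithin] with t ht
  rw [Real.dist_eq]
  exact h t ht s hs

theorem good_dense {d : ℕ} (P : ℝ → Eu d → Prop)
    (h : ∀ᵐ z ∂(volume.restrict (parNeg d)), P z.1 z.2) :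
    Dense {x : Eu d | ∀ᵐ t ∂(volume.restrict (Iio (0 : ℝ))), P t x} := by
  have e : (volume.restrict (parNeg d) : Measure (ℝ × Eu d)) =
      ((volume : Measure ℝ).restrict (Iio 0)).prod (volume : Measure (Eu d)) := by
    rw [parNeg, Measure.volume_eq_prod, ← Measure.prod_restrict, Measure.restrict_univ]
  rw [e] at h
  have h2 : ∀ᵐ z ∂((volume : Measure (Eu d)).prod ((volume : Measure ℝ).restrict (Iio 0))), P z.2 z.1 := by
    have := (Measure.measurePreserving_swap (μ := (volume : Measure (Eu d)))
      (ν := (volume : Measure ℝ).restrict (Iio 0))).quasiMeasurePreserving.ae h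
    exact this
  exact Measure.dense_of_ae (Measure.ae_ae_of_ae_prod h2)

theorem qe_of_eq {d : ℕ} {ν γ K : ℝ} (hν : 0 < ν) (hγ : 0 < γ)
    (a : Fin d → Fin d → ℝ → Eu d → ℝ) (u f : ℝ → Eu d → ℝ)
    (hs : ∀ i j t x, a i j t x = a j i t x) (he : UnifEllipticP d ν a)
    (ht : ∀ i j (t s : ℝ) (x : Eu d), a i j t x = a i j s x)
    (hu : ParClassical (parNeg d) u)
    (heq : ∀ᵐ z ∂(volume.restrict (parNeg d)),
          td u z.1 z.2 - ∑ i, ∑ j, a i j z.1 z.2 * sd2 i j (u z.1) z.2 = f z.1 z.2)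
    (hf : HolderTPar d γ (parNeg d) f K) : QE ν γ K (td u) (hU u) := by
  have hm : ∀ t < 0, ∀ x : Eu d, (t, x) ∈ parNeg d := fun t ht x => ⟨ht, mem_univ _⟩
  have htc := tc_of_classical u hu
  set A : Eu d → Fin d → Fin d → ℝ := fun x i j => a i j 0 x with hA
  have hAE : ∀ x, Ell d ν (A x) := fun x => ⟨fun i j => hs i j 0 x, fun ξ => he 0 x ξ⟩
  have hc : ∀ (B : Fin d → Fin d → ℝ) x, ContinuousOn (fun t => td u t x - trA B (hU u t x)) (Iio 0) := by
    intro B x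
    have i1 : ContinuousOn (fun t : ℝ => (t, x)) (Iio 0) := by fun_prop
    have i2 : MapsTo (fun t : ℝ => (t, x)) (Iio 0) (parNeg d) := fun t ht => hm t ht x
    have c1 := htc.ct.comp i1 i2
    have c2 := (trL B).continuous.comp_continuousOn (htc.cH.comp i1 i2)
    refine (c1.sub c2).congr fun t ht => ?_
    simp [trL_apply]
  set P : ℝ → Eu d → Prop := fun t x =>
    td u t x - ∑ i, ∑ j, a i j t x * sd2 i j (u t) x = f t x with hP
  have hD := good_dense P heq
  have key : ∀ x ∈ {x : Eu d | ∀ᵐ t ∂(volume.restrict (Iio (0 : ℝ))), P t x}, ∀ t < 0,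
      td u t x - trA (A x) (hU u t x) = f t x := by
    intro x hx
    have hfc : ContinuousOn (fun t => f t x) (Iio 0) :=
      holder_cont hγ (fun t ht s hs => hf t s x (hm t ht x) (hm s hs x))
    have := Measure.eqOn_open_of_ae_eq (μ := (volume : Measure ℝ)) (U := Iio (0 : ℝ))
      (f := fun t => td u t x - trA (A x) (hU u t x)) (g := fun t => f t x) ?_ isOpen_Iio (hc _ x) hfc
    · intro t ht
      exact this ht
    · have hx' : ∀ᵐ t ∂(volume.restrict (Iio (0 : ℝ))), P t x := hx
      filter_upwards [hx', ae_restrict_mem measurableSet_Iio] with t h1 h2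
      rw [trA_hU u t x (hu.2.1 (t, x) (hm t h2 x)), ← h1]
      simp only [hA]
      congr 1
      refine Finset.sum_congr rfl fun i _ => Finset.sum_congr rfl fun j _ => ?_
      rw [ht i j 0 t x]
  intro x
  obtain ⟨y, hyG, hyx⟩ := mem_closure_iff_seq_limit.1 (hD x)
  obtain ⟨B, hB, φ, hφ, hφB⟩ := (ell_compact hν).tendsto_subseq (x := fun n => A (y n)) (fun n => hAE (y n))
  refine ⟨B, hB, ?_⟩
  intro t ht' s hs'
  have hy2 := hyx.comp hφ.tendsto_atTop
  have lim : ∀ t < 0, Tendsto (fun n => td u t (y (φ n)) - trA (A (y (φ n))) (hU u t (y (φ n)))) atTop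
      (nhds (td u t x - trA B (hU u t x))) := by
    intro t ht
    have hn : parNeg d ∈ nhds (t, x) := (isOpen_Iio.prod isOpen_univ).mem_nhds (hm t ht x)
    have l0 : Tendsto (fun n => (t, y (φ n))) atTop (nhds (t, x)) := tendsto_const_nhds.prodMk_nhds hy2
    have l1 := (htc.ct.continuousAt hn).tendsto.comp l0
    have l2 := (htc.cH.continuousAt hn).tendsto.comp l0
    refine Tendsto.sub l1 ?_
    unfold trA
    refine tendsto_finsetSum _ fun i _ => tendsto_finsetSum _ fun j _ => ?_
    refine Tendsto.mul ?_ ?_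
    · exact ((continuous_apply_apply (ρ := fun _ _ => ℝ) i j).tendsto B).comp hφB
    · have c : Continuous (fun L : Eu d →L[ℝ] Eu d => (L (EuclideanSpace.single i 1)) j) := by fun_prop
      exact (c.tendsto _).comp l2
  have := ((lim t ht').sub (lim s hs')).abs
  refine le_of_tendsto this (Eventually.of_forall fun n => ?_)
  rw [key _ (hyG _) t ht', key _ (hyG _) s hs']
  exact hf t s _ (hm t ht' _) (hm s hs' _)
/-- **Theorem 4.1 (i), second case**: partial Schauder estimate in `t` on
`(-∞,0) × ℝ^d` for non-divergence form parabolic equations with coefficients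
independent of `t`. -/
theorem partial_schauder_parabolic_wholespace_t
    (d q : ℕ) (ν δ : ℝ) (hd : 2 ≤ d) (hq1 : 1 ≤ q) (hqd : q < d)
    (hν : ν ∈ Ioc (0 : ℝ) 1) (hδ : δ ∈ Ioo (0 : ℝ) 1) :
    ∃ N : ℝ, 0 < N ∧
      ∀ (a : Fin d → Fin d → ℝ → EuclideanSpace ℝ (Fin d) → ℝ)
        (u f : ℝ → EuclideanSpace ℝ (Fin d) → ℝ),
        (∀ i j, Measurable (fun z : ℝ × EuclideanSpace ℝ (Fin d) => a i j z.1 z.2)) →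
        (∀ i j t x, a i j t x = a j i t x) →
        UnifEllipticP d ν a →
        (∀ i j (t s : ℝ) (x : EuclideanSpace ℝ (Fin d)), a i j t x = a i j s x) →
        ParClassical (parNeg d) u →
        (∃ M : ℝ, ∀ z ∈ parNeg d, |u z.1 z.2| ≤ M) →
        (∀ᵐ z ∂(volume.restrict (parNeg d)),
          td u z.1 z.2 - ∑ i, ∑ j, a i j z.1 z.2 * sd2 i j (u z.1) z.2 = f z.1 z.2) →
        ∀ K : ℝ, 0 ≤ K → HolderTPar d (δ/2) (parNeg d) f K →
          HolderTPar d (δ/2) (parNeg d) (td u) (N * K) := by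
  obtain ⟨N, hN, h⟩ := main_est d ν (δ / 2) hν.1 (by linarith [hδ.1]) (by linarith [hδ.2])
  refine ⟨N, hN, ?_⟩
  intro a u f _ hs he ht hu hM heq K hK hf
  obtain ⟨M, hM⟩ := hM
  have hγ : 0 < δ / 2 := by linarith [hδ.1]
  have h1 := h u (td u) (gU u) (hU u) K M (tc_of_classical u hu)
    (qe_of_eq hν.1 hγ a u f hs he ht hu heq hf) hK (fun t ht x => hM (t, x) ⟨ht, mem_univ _⟩)
  intro t s x htx hsx
  have ht0 : t < 0 := htx.1
  have hs0 : s < 0 := hsx.1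
  rcases lt_trichotomy t s with hlt | hlt | hlt
  · have := h1 s hs0 (s - t) (by linarith) x
    rw [sub_sub_cancel] at this
    rw [abs_sub_comm, abs_sub_comm t s, abs_of_pos (sub_pos.2 hlt)]
    exact this
  · subst hlt
    simp [Real.zero_rpow hγ.ne']
  · have := h1 t ht0 (t - s) (by linarith) x
    rw [sub_sub_cancel] at this
    rw [abs_of_pos (sub_pos.2 hlt)]
    exact this
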